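/- arXiv:1806.00152 — 2 statements merged into one kernel-verified Lean document; each statement's English description precedes it below -/
import Mathlib

section
/- Let q be a prime power, 1 ≤ k ≤ q, and 0 ≤ r ≤ k − 1. The number N(0, r) of polynomials g ∈ F_q[x] of degree at most k−1 that have exactly r distinct roots in F_q equals C(q, r) · q^{k−r−1} · (q−1) · Σ_{j=0}^{k−r−1} (−1)^j C(q−r−1, j) q^{−j}. -/
open Polynomial in
def PS {F : Type*} [Field F] (m : ℕ) (T : Finset F) : Set (Polynomial F) :=
  {h | h.degree < (m : ℕ) ∧ ∀ a ∈ T, h.eval a ≠ 0}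

lemma degLT_card {F : Type*} [Field F] [Fintype F] (m : ℕ) :
    {h : Polynomial F | h.degree < (m : ℕ)}.Finite ∧
    {h : Polynomial F | h.degree < (m : ℕ)}.ncard = Fintype.card F ^ m := by
  have e := (Polynomial.degreeLTEquiv F m).toEquiv
  have h1 : {h : Polynomial F | h.degree < (m : ℕ)} = (Polynomial.degreeLT F m : Set (Polynomial F)) := by
    ext h; simp [Polynomial.mem_degreeLT]
  rw [h1]
  constructor
  · have : Finite (Polynomial.degreeLT F m) := Finite.of_equiv _ e.symm
    exact Set.toFinite _
  · rw [← Nat.card_coe_set_eq]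
    have := Nat.card_congr e
    rw [show Nat.card (Polynomial.degreeLT F m : Set (Polynomial F)) = Nat.card (Polynomial.degreeLT F m) from rfl, this]
    simp

lemma PS_finite {F : Type*} [Field F] [Fintype F] (m : ℕ) (T : Finset F) : (PS m T).Finite :=
  (degLT_card m).1.subset fun _ h => h.1

lemma deg_mul_iff {F : Type*} [Field F] (h Q : Polynomial F) (hQ : Q.Monic) (m : ℕ) :
    (h * Q).degree < ((m + Q.natDegree : ℕ) : WithBot ℕ) ↔ h.degree < (m : ℕ) := by
  by_cases h0 : h = 0
  · simp [h0]
  · rw [← Polynomial.natDegree_lt_iff_degree_lt (mul_ne_zero h0 hQ.ne_zero),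
      ← Polynomial.natDegree_lt_iff_degree_lt h0, Polynomial.natDegree_mul h0 hQ.ne_zero]
    omega

lemma PS_rec {F : Type*} [Field F] [Fintype F] [DecidableEq F] (m : ℕ) (T : Finset F) (a : F)
    (ha : a ∉ T) : (PS (m+1) T).ncard = (PS (m+1) (insert a T)).ncard + (PS m T).ncard := by
  have hinj : Function.Injective (fun h : Polynomial F => h * (Polynomial.X - Polynomial.C a)) :=
    mul_left_injective₀ (Polynomial.X_sub_C_ne_zero a)
  rw [← Set.ncard_image_of_injective (PS m T) hinj, ← Set.ncard_union_eq ?_ (PS_finite _ _) ((PS_finite _ _).image _)]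
  · congr 1
    ext g
    have hd := fun h : Polynomial F => deg_mul_iff h _ (Polynomial.monic_X_sub_C a) m
    simp only [Polynomial.natDegree_X_sub_C] at hd
    simp only [PS, Set.mem_union, Set.mem_ofPred_eq, Set.mem_image]
    constructor
    · rintro ⟨h1, h2⟩
      by_cases h3 : g.eval a = 0
      · right
        obtain ⟨h, rfl⟩ := Polynomial.dvd_iff_isRoot.2 h3
        rw [mul_comm] at h1 
        refine ⟨h, ⟨(hd h).1 h1, fun b hb hb0 => h2 b hb (by simp [hb0])⟩, mul_comm _ _⟩
      · left
        refine ⟨h1, fun b hb => ?_⟩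
        rcases Finset.mem_insert.1 hb with rfl | hb
        · exact h3
        · exact h2 b hb
    · rintro (⟨h1, h2⟩ | ⟨h, ⟨h1, h2⟩, rfl⟩)
      · exact ⟨h1, fun b hb => h2 b (Finset.mem_insert_of_mem hb)⟩
      · refine ⟨(hd h).2 h1, fun b hb => ?_⟩
        simp only [Polynomial.eval_mul, Polynomial.eval_sub, Polynomial.eval_X, Polynomial.eval_C]
        refine mul_ne_zero (h2 b hb) (sub_ne_zero.2 ?_)
        rintro rfl
        exact ha hb
  · rw [Set.disjoint_left]
    rintro g ⟨_, h2⟩ ⟨h, _, rfl⟩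
    exact h2 a (Finset.mem_insert_self _ _) (by simp)

lemma PS_zero {F : Type*} [Field F] (T : Finset F) (hT : T.Nonempty) : (PS 0 T).ncard = 0 := by
  obtain ⟨a, ha⟩ := hT
  have : PS 0 T = ∅ := by
    ext g
    simp only [PS, Set.mem_ofPred_eq, Set.mem_empty_iff_false, iff_false]
    rintro ⟨h1, h2⟩
    have : g = 0 := by
      rw [← Polynomial.degree_eq_bot]
      simpa using h1
    exact h2 a ha (by simp [this])
  simp [this]

lemma PS_card {F : Type*} [Field F] [Fintype F] [DecidableEq F] (n : ℕ) :
    ∀ (m : ℕ) (T : Finset F), T.card = n + 1 → ((PS m T).ncard : ℝ) =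
      (Fintype.card F : ℝ) ^ (m - 1) * ((Fintype.card F : ℝ) - 1) *
      ∑ j ∈ Finset.range m, (-1 : ℝ) ^ j * (n.choose j : ℝ) * ((Fintype.card F : ℝ)⁻¹) ^ j := by
  have hq : (Fintype.card F : ℝ) ≠ 0 := by
    exact_mod_cast Fintype.card_ne_zero
  set q : ℝ := (Fintype.card F : ℝ) with hqd
  induction n with
  | zero =>
    intro m T hT
    obtain ⟨a, rfl⟩ := Finset.card_eq_one.1 hT
    cases m with
    | zero => simp [PS_zero]
    | succ m =>
      have h := PS_rec m ∅ a (by simp)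
      have he : ∀ m, (PS m (∅ : Finset F)).ncard = Fintype.card F ^ m := fun m => by
        simpa [PS] using (degLT_card (F := F) m).2
      rw [he, he] at h
      have h' : q ^ (m+1) = ((PS (m+1) ({a} : Finset F)).ncard : ℝ) + q ^ m := by
        rw [hqd]; exact_mod_cast h
      rw [Finset.sum_range_succ']
      simp
      linear_combination -h'
  | succ n ih =>
    intro m T hT
    obtain ⟨a, T', ha, rfl, hT'⟩ := Finset.card_eq_succ.1 hT
    cases m with
    | zero => simp [PS_zero]
    | succ m =>
      have h := PS_rec m T' a ha
      have h' : ((PS (m+1) T').ncard : ℝ) = ((PS (m+1) (insert a T')).ncard : ℝ) + ((PS m T').ncard : ℝ) := by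
        exact_mod_cast h
      rw [ih _ _ hT', ih _ _ hT'] at h'
      have h2 : ((PS (m+1) (insert a T')).ncard : ℝ) = _ := (eq_sub_of_add_eq h'.symm)
      rw [h2, Finset.sum_range_succ', Finset.sum_range_succ' _ m]
      have h3 : q ^ (m-1) * (q-1) * ∑ j ∈ Finset.range m, (-1 : ℝ) ^ j * (n.choose j : ℝ) * (q⁻¹) ^ j
         = - (q ^ m * (q-1) * ∑ j ∈ Finset.range m, (-1 : ℝ) ^ (j+1) * (n.choose j : ℝ) * (q⁻¹) ^ (j+1)) := by
        cases m with
        | zero => simp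
        | succ m =>
          simp only [pow_succ _ (_ : ℕ), Nat.add_sub_cancel, Finset.mul_sum, ← Finset.sum_neg_distrib]
          refine Finset.sum_congr rfl fun j _ => ?_
          field_simp
      rw [h3]
      have h4 : ∑ j ∈ Finset.range m, (-1 : ℝ) ^ (j+1) * ((n+1).choose (j+1) : ℝ) * (q⁻¹) ^ (j+1)
        = ∑ j ∈ Finset.range m, (-1 : ℝ) ^ (j+1) * (n.choose j : ℝ) * (q⁻¹) ^ (j+1) + 
         ∑ j ∈ Finset.range m, (-1 : ℝ) ^ (j+1) * (n.choose (j+1) : ℝ) * (q⁻¹) ^ (j+1) := by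
        rw [← Finset.sum_add_distrib]
        refine Finset.sum_congr rfl fun j _ => ?_
        rw [Nat.choose_succ_succ]; push_cast; ring
      rw [h4]
      simp only [Nat.add_sub_cancel, Nat.choose_zero_right]
      ring

lemma fiber_card {F : Type*} [Field F] [Fintype F] [DecidableEq F] (m : ℕ) (R : Finset F) :
    {g : Polynomial F | g.degree < ((m + R.card : ℕ) : WithBot ℕ) ∧
      Finset.univ.filter (fun a : F => g.eval a = 0) = R}.ncard = (PS m Rᶜ).ncard := by
  set Q : Polynomial F := ∏ a ∈ R, (Polynomial.X - Polynomial.C a) with hQ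
  have hm : Q.Monic := Polynomial.monic_prod_X_sub_C _ _
  have hn : Q.natDegree = R.card := Polynomial.natDegree_finsetProd_X_sub_C_eq_card _ _
  have hev : ∀ b, Q.eval b = 0 ↔ b ∈ R := by
    intro b
    rw [hQ, Polynomial.eval_prod, Finset.prod_eq_zero_iff]
    simp [sub_eq_zero]
  have hinj : Function.Injective (fun h : Polynomial F => h * Q) :=
    mul_left_injective₀ hm.ne_zero
  rw [← Set.ncard_image_of_injective (PS m Rᶜ) hinj]
  congr 1
  ext g
  simp only [PS, Set.mem_ofPred_eq, Set.mem_image]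
  rw [← hn]
  constructor
  · rintro ⟨h1, h2⟩
    have hdvd : Q ∣ g := by
      refine Finset.prod_dvd_of_coprime ?_ ?_
      · intro a _ b _ hab
        exact Polynomial.pairwise_coprime_X_sub_C (s := fun a : F => a) Function.injective_id hab
      · intro a ha
        rw [← h2] at ha
        exact Polynomial.dvd_iff_isRoot.2 (by simpa using ha)
    obtain ⟨h, rfl⟩ := hdvd
    rw [mul_comm] at h1
    refine ⟨h, ⟨(deg_mul_iff h Q hm m).1 h1, fun b hb hb0 => ?_⟩, mul_comm _ _⟩
    rw [Finset.mem_compl] at hb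
    apply hb
    rw [← h2]
    simp [hb0]
  · rintro ⟨h, ⟨h1, h2⟩, rfl⟩
    refine ⟨(deg_mul_iff h Q hm m).2 h1, ?_⟩
    ext b
    have := h2 b
    have := hev b
    simp only [Finset.mem_filter, Finset.mem_univ, true_and, Polynomial.eval_mul, mul_eq_zero]
    simp only [Finset.mem_compl] at *
    tauto



/-- MacWilliams-type formula: the number of polynomials `g` of degree at
most `k-1` with exactly `r` distinct roots in `F_q` equals
`C(q,r) q^(k-r-1) (q-1) ∑_{j=0}^{k-r-1} (-1)^j C(q-r-1, j) q^(-j)`. -/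
theorem stmt_8 {F : Type*} [Field F] [Fintype F] [DecidableEq F]
    (q k r : ℕ) (hcard : Fintype.card F = q)
    (hk : 1 ≤ k) (hkq : k ≤ q) (hr : r ≤ k - 1) :
    (Nat.card {g : Polynomial F // g.degree < (k : ℕ) ∧
        (Finset.univ.filter (fun a : F => g.eval a = 0)).card = r} : ℝ)
      = (q.choose r : ℝ) * (q : ℝ) ^ (k - r - 1) * ((q : ℝ) - 1) *
          ∑ j ∈ Finset.range (k - r), (-1 : ℝ) ^ j * ((q - r - 1).choose j : ℝ) *
            ((q : ℝ)⁻¹) ^ j := by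
  subst hcard
  obtain ⟨m, rfl⟩ : ∃ m, k = m + r := ⟨k - r, by omega⟩
  have hfin := (degLT_card (F := F) (m + r)).1
  let S := hfin.toFinset
  let Z : Polynomial F → Finset F := fun g => Finset.univ.filter (fun a : F => g.eval a = 0)
  have h1 : Nat.card {g : Polynomial F // g.degree < ((m + r : ℕ) : WithBot ℕ) ∧
        (Finset.univ.filter (fun a : F => g.eval a = 0)).card = r} =
      (S.filter (fun g => (Z g).card = r)).card := by
    rw [← Set.ncard_coe_finset, ← Nat.card_coe_set_eq]
    refine Nat.card_congr (Equiv.subtypeEquivRight fun g => ?_)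
    simp [S, Z]
  have h2 := Finset.card_eq_sum_card_fiberwise (f := Z) (s := S.filter (fun g => (Z g).card = r))
    (t := Finset.powersetCard r Finset.univ) (by
      intro g hg
      simp only [Finset.coe_filter, Set.mem_ofPred_eq] at hg
      simp [hg.2])
  rw [h1, h2]
  push_cast
  have h3 : ∀ R ∈ Finset.powersetCard r (Finset.univ : Finset F),
      ((((S.filter (fun g => (Z g).card = r)).filter (fun g => Z g = R)).card : ℕ) : ℝ) =
      (Fintype.card F : ℝ) ^ (m - 1) * ((Fintype.card F : ℝ) - 1) *
      ∑ j ∈ Finset.range m, (-1 : ℝ) ^ j * ((Fintype.card F - r - 1).choose j : ℝ) * ((Fintype.card F : ℝ)⁻¹) ^ j := by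
    intro R hR
    have hR' := (Finset.mem_powersetCard.1 hR).2
    rw [← PS_card _ m Rᶜ (by rw [Finset.card_compl]; omega), ← fiber_card, ← Set.ncard_coe_finset]
    congr 2
    ext g
    simp only [S, Z, hR', Finset.coe_filter, Finset.mem_filter, Set.mem_ofPred_eq, Set.Finite.mem_toFinset]
    constructor
    · tauto
    · rintro ⟨h, h'⟩
      exact ⟨⟨h, by rw [h', hR']⟩, h'⟩
  rw [Finset.sum_congr rfl h3, Finset.sum_const, Finset.card_powersetCard, Finset.card_univ,
    nsmul_eq_mul, Nat.add_sub_cancel]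
  ring
end

section
/- Let q be a prime power with characteristic p, and let f(x) ∈ F_q[x] have degree k+m with 1 ≤ k, 0 ≤ m, and k+m ≤ q−1. For 0 ≤ r ≤ k+m, let N(f, r) be the number of polynomials g ∈ F_q[x] of degree at most k−1 such that f(x)+g(x) has exactly r distinct roots in F_q, and let μ_s = Σ_{j=0}^{s} (−1)^j C(q−r, j) q^{−j}. Then |N(f, r) − μ_{k+m−r} · C(q, r) · q^{k−r}| ≤ Σ_{j=k+1}^{k+m} C(j, r) · C(q/p + m√q + j, j) · C(m−1, k+m−j) · q^{(k+m−j)/2}. -/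
open Polynomial

/-- Generalized (real-argument) binomial coefficient `C(a,b) = Γ(a+1)/(Γ(b+1)Γ(a-b+1))`. -/
noncomputable def gchoose (a b : ℝ) : ℝ :=
  Real.Gamma (a + 1) / (Real.Gamma (b + 1) * Real.Gamma (a - b + 1))


namespace Step

def wt (q m i : ℕ) : ℕ := q ^ (m - 1 - i) * ∑ l ∈ Finset.range (i + 1), q ^ l

def W (q m : ℕ) (e : ℕ → ℕ) : ℕ := ∑ i ∈ Finset.range m, e i * wt q m i

def Red (q m : ℕ) (e : ℕ → ℕ) : Prop := (∀ i, 1 ≤ i → e i < q) ∧ ∀ i, m ≤ i → e i = 0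

lemma wt_succ (q m i : ℕ) (h : i < m) : wt q (m + 1) i = q * wt q m i := by
  unfold wt
  have : m + 1 - 1 - i = (m - 1 - i) + 1 := by omega
  rw [this, pow_succ]; ring

lemma wt_last (q m : ℕ) : ∃ t, wt q (m + 1) m = q * t + 1 := by
  refine ⟨∑ l ∈ Finset.range m, q ^ l, ?_⟩
  unfold wt
  have : m + 1 - 1 - m = 0 := by omega
  rw [this, Finset.sum_range_succ', Finset.mul_sum]
  simp [pow_succ, mul_comm]

lemma W_succ (q m : ℕ) (e : ℕ → ℕ) : W q (m + 1) e = q * W q m e + e m * wt q (m + 1) m := by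
  unfold W
  rw [Finset.sum_range_succ, Finset.mul_sum]
  congr 1
  apply Finset.sum_congr rfl
  intro i hi
  rw [wt_succ q m i (Finset.mem_range.1 hi)]; ring

lemma W_congr (q m : ℕ) (e e' : ℕ → ℕ) (h : ∀ i < m, e i = e' i) : W q m e = W q m e' := by
  unfold W
  apply Finset.sum_congr rfl
  intro i hi
  rw [h i (Finset.mem_range.1 hi)]

lemma W_inj_aux (q : ℕ) (hq : 0 < q) (m : ℕ) (e e' : ℕ → ℕ) (he : ∀ i, 1 ≤ i → e i < q)
    (he' : ∀ i, 1 ≤ i → e' i < q) (h : W q (m + 1) e = W q (m + 1) e') :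
    ∀ i < m + 1, e i = e' i := by
  induction m with
  | zero =>
    intro i hi
    have : i = 0 := by omega
    subst this
    simpa [W, wt] using h
  | succ m ih =>
    rw [W_succ q (m + 1), W_succ q (m + 1)] at h
    obtain ⟨t, ht⟩ := wt_last q (m + 1)
    rw [ht] at h
    have hm : e (m + 1) = e' (m + 1) := by
      have h1 := congrArg (fun x => x % q) h
      try simp only at h1
      have aux : ∀ A b, (q * A + b * (q * t + 1)) % q = b % q := by
        intro A b
        have : q * A + b * (q * t + 1) = b + q * (A + b * t) := by ring
        rw [this, Nat.add_mul_mod_self_left]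
      rw [aux, aux, Nat.mod_eq_of_lt (he _ (by omega)), Nat.mod_eq_of_lt (he' _ (by omega))] at h1
      exact h1
    rw [hm] at h
    have h2 : W q (m + 1) e = W q (m + 1) e' := by
      have := Nat.add_right_cancel h
      exact Nat.eq_of_mul_eq_mul_left hq this
    intro i hi
    rcases Nat.lt_succ_iff_lt_or_eq.1 hi with h3 | h3
    · exact ih h2 i h3
    · rw [h3, hm]

lemma W_inj (q : ℕ) (hq : 0 < q) (m : ℕ) (hm : 1 ≤ m) (e e' : ℕ → ℕ) (he : Red q m e)
    (he' : Red q m e') (h : W q m e = W q m e') : e = e' := by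
  obtain ⟨n, rfl⟩ : ∃ n, m = n + 1 := ⟨m - 1, by omega⟩
  funext i
  by_cases hi : i < n + 1
  · exact W_inj_aux q hq n e e' he.1 he'.1 h i hi
  · rw [he.2 i (by omega), he'.2 i (by omega)]

lemma W_surj (q : ℕ) (hq : 0 < q) (m : ℕ) :
    ∃ c, ∀ D, c ≤ D → ∃ e, Red q (m + 1) e ∧ W q (m + 1) e = D := by
  induction m with
  | zero =>
    refine ⟨0, fun D _ => ⟨fun i => if i = 0 then D else 0, ⟨?_, ?_⟩, ?_⟩⟩
    · intro i hi
      have : i ≠ 0 := by omega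
      simp [this, hq]
    · intro i hi
      have : i ≠ 0 := by omega
      simp [this]
    · simp [W, wt]
  | succ m ih =>
    obtain ⟨c, hc⟩ := ih
    obtain ⟨t, ht⟩ := wt_last q (m + 1)
    refine ⟨q * (q * t + 1) + q * c, fun D hD => ?_⟩
    have hlt : D % q < q := Nat.mod_lt _ hq
    have hb : (D % q) * t + c ≤ D / q := by
      rw [Nat.le_div_iff_mul_le hq]
      have : (D % q) * t ≤ q * t := Nat.mul_le_mul_right _ hlt.le
      calc ((D % q) * t + c) * q ≤ (q * t + c) * q := by gcongr
        _ ≤ D := by nlinarith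
    obtain ⟨e, he, heW⟩ := hc (D / q - (D % q) * t) (by omega)
    refine ⟨fun i => if i = m + 1 then D % q else e i, ⟨?_, ?_⟩, ?_⟩
    · intro i hi
      by_cases h : i = m + 1
      · simp [h, hlt]
      · simp [h, he.1 i hi]
    · intro i hi
      have h : i ≠ m + 1 := by omega
      simp [h, he.2 i (by omega)]
    · rw [W_succ, ht, W_congr q (m + 1) _ e, heW]
      · simp only [if_true]
        have h1 := Nat.div_add_mod D q
        obtain ⟨x, hx⟩ := Nat.exists_eq_add_of_le (show (D % q) * t ≤ D / q by omega)
        rw [hx] at h1 ⊢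
        rw [Nat.add_sub_cancel_left]
        nlinarith
      · intro i hi
        have h : i ≠ m + 1 := by omega
        simp [h]

section Alg

variable {k Ω : Type*} [Field k] [CommRing Ω] [Algebra k Ω]

def mono (m : ℕ) (Y : ℕ → Ω) (e : ℕ → ℕ) : Ω := ∏ i ∈ Finset.range m, Y (i + 1) ^ e i

variable (k) in
def NN (q m : ℕ) (Y : ℕ → Ω) : Submodule k Ω :=
  Submodule.span k {x | ∃ e, Red q m e ∧ x = mono m Y e}

lemma mono_update (m : ℕ) (Y : ℕ → Ω) (e : ℕ → ℕ) (i : ℕ) (hi : i < m) (a : ℕ) :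
    mono m Y (Function.update e i (a + e i)) = Y (i + 1) ^ a * mono m Y e := by
  unfold mono
  rw [← Finset.mul_prod_erase _ _ (Finset.mem_range.2 hi),
    ← Finset.mul_prod_erase (Finset.range m) (fun i => Y (i + 1) ^ e i) (Finset.mem_range.2 hi)]
  rw [Function.update_self, pow_add, mul_assoc]
  congr 2
  apply Finset.prod_congr rfl
  intro j hj
  rw [Function.update_of_ne (Finset.ne_of_mem_erase hj)]

lemma mul_mem_of_mono (N N' : Submodule k Ω) (S : Set Ω) (hS : N = Submodule.span k S) (y : Ω)
    (h : ∀ x ∈ S, y * x ∈ N') : ∀ x ∈ N, y * x ∈ N' := by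
  intro x hx
  rw [hS] at hx
  induction hx using Submodule.span_induction with
  | mem x hx => exact h x hx
  | zero => simp
  | add x z _ _ h1 h2 => rw [mul_add]; exact N'.add_mem h1 h2
  | smul a x _ h1 => rw [mul_smul_comm]; exact N'.smul_mem _ h1

lemma NN_mul_Y0 (q m : ℕ) (hm : 1 ≤ m) (Y : ℕ → Ω) :
    ∀ x ∈ NN k q m Y, Y 1 * x ∈ NN k q m Y := by
  apply mul_mem_of_mono _ _ _ rfl
  rintro _ ⟨e, he, rfl⟩
  have := mono_update m Y e 0 (by omega) 1
  rw [zero_add, pow_one] at this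
  rw [← this]
  apply Submodule.subset_span
  refine ⟨_, ⟨?_, ?_⟩, rfl⟩
  · intro i hi
    rw [Function.update_of_ne (by omega)]; exact he.1 i hi
  · intro i hi
    rw [Function.update_of_ne (by omega)]; exact he.2 i hi

lemma NN_pow (q m : ℕ) (Y : ℕ → Ω) (y : Ω) (h : ∀ x ∈ NN k q m Y, y * x ∈ NN k q m Y) (n : ℕ) :
    ∀ x ∈ NN k q m Y, y ^ n * x ∈ NN k q m Y := by
  induction n with
  | zero => intro x hx; simpa using hx
  | succ n ih => intro x hx; rw [pow_succ, mul_assoc]; exact ih _ (h x hx)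

lemma NN_mul_Y (q m : ℕ) (hq : 2 ≤ q) (hm : 1 ≤ m) (Y : ℕ → Ω)
    (hY : ∀ i, Y (i + 1) ^ q = Y (i + 1) + (Y 1 ^ q - Y 1) * Y i) (i : ℕ) (hi : i < m) :
    ∀ x ∈ NN k q m Y, Y (i + 1) * x ∈ NN k q m Y := by
  induction i with
  | zero => exact NN_mul_Y0 q m hm Y
  | succ i ih =>
    apply mul_mem_of_mono _ _ _ rfl
    rintro _ ⟨e, he, rfl⟩
    by_cases hlt : e (i + 1) + 1 < q
    · have := mono_update m Y e (i + 1) hi 1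
      rw [pow_one] at this
      rw [← this]
      apply Submodule.subset_span
      refine ⟨_, ⟨?_, ?_⟩, rfl⟩
      · intro j hj
        by_cases h : j = i + 1
        · subst h; rw [Function.update_self]; omega
        · rw [Function.update_of_ne h]; exact he.1 j hj
      · intro j hj
        rw [Function.update_of_ne (by omega)]; exact he.2 j hj
    · have heq : e (i + 1) = q - 1 := by have := he.1 (i + 1) (by omega); omega
      set e' := Function.update e (i + 1) 0 with he'
      have hred : ∀ b, b < q → Red q m (Function.update e (i + 1) b) := by
        intro b hb
        refine ⟨?_, ?_⟩
        · intro j hj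
          by_cases h : j = i + 1
          · subst h; rw [Function.update_self]; omega
          · rw [Function.update_of_ne h]; exact he.1 j hj
        · intro j hj
          rw [Function.update_of_ne (by omega)]; exact he.2 j hj
      have h0 : e' (i + 1) = 0 := by simp [he']
      have h1 : mono m Y e = Y (i + 1 + 1) ^ (q - 1) * mono m Y e' := by
        rw [← mono_update m Y e' (i + 1) hi (q - 1)]
        congr 1
        rw [h0, he', Function.update_idem, add_zero, ← heq, Function.update_eq_self]
      have h2 : Y (i + 1 + 1) * mono m Y e = Y (i + 1 + 1) ^ 1 * mono m Y e'
          + (Y 1 ^ q * (Y (i + 1) * mono m Y e') - Y 1 * (Y (i + 1) * mono m Y e')) := by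
        rw [h1, ← mul_assoc, ← pow_succ', show q - 1 + 1 = q by omega, hY (i + 1)]
        ring
      have hm' : mono m Y e' ∈ NN k q m Y := Submodule.subset_span ⟨e', hred 0 (by omega), rfl⟩
      have hi' := ih (by omega) _ hm'
      rw [h2]
      refine Submodule.add_mem _ ?_ (Submodule.sub_mem _ ?_ ?_)
      · rw [← mono_update m Y e' (i + 1) hi 1, h0, he', Function.update_idem]
        exact Submodule.subset_span ⟨_, hred _ (by omega), rfl⟩
      · exact NN_pow q m Y _ (NN_mul_Y0 q m hm Y) q _ hi'
      · exact NN_mul_Y0 q m hm Y _ hi'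

lemma NN_one (q m : ℕ) (hq : 2 ≤ q) (Y : ℕ → Ω) : (1 : Ω) ∈ NN k q m Y := by
  apply Submodule.subset_span
  refine ⟨fun _ => 0, ⟨fun _ _ => by show 0 < q; omega, fun _ _ => rfl⟩, ?_⟩
  simp [mono]

lemma NN_mul (q m : ℕ) (hq : 2 ≤ q) (hm : 1 ≤ m) (Y : ℕ → Ω)
    (hY : ∀ i, Y (i + 1) ^ q = Y (i + 1) + (Y 1 ^ q - Y 1) * Y i) (x y : Ω)
    (hx : x ∈ NN k q m Y) (hy : y ∈ NN k q m Y) : x * y ∈ NN k q m Y := by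
  rw [mul_comm]
  refine mul_mem_of_mono _ _ _ rfl y ?_ x hx
  rintro _ ⟨e, _, rfl⟩
  rw [mul_comm]
  suffices h : ∀ s : Finset ℕ, s ⊆ Finset.range m →
      (∏ i ∈ s, Y (i + 1) ^ e i) * y ∈ NN k q m Y from h _ (Finset.Subset.refl _)
  intro s
  induction s using Finset.induction_on with
  | empty => intro _; simpa using hy
  | insert a s ha ih =>
    intro hs
    rw [Finset.prod_insert ha, mul_assoc]
    exact NN_pow q m Y _ (NN_mul_Y q m hq hm Y hY a
      (Finset.mem_range.1 (hs (Finset.mem_insert_self _ _)))) _ _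
      (ih (fun z hz => hs (Finset.mem_insert_of_mem hz)))

end Alg
end Step


namespace Step

section Val

variable {k K Γ : Type*} [Field k] [Field K] [Algebra k K] [LinearOrderedCommGroupWithZero Γ]

lemma val_sum {ι : Type*} (v : Valuation K Γ) (hv : ∀ c : k, c ≠ 0 → v (algebraMap k K c) = 1)
    (α : Γ) (hα : 1 < α) (M : ℕ) (hM : M ≠ 0) (s : Finset ι) (x : ι → K) (c : ι → k) (w : ι → ℕ)
    (hw : ∀ i ∈ s, ∀ j ∈ s, w i = w j → i = j) (hx : ∀ i ∈ s, v (x i) ^ M = α ^ w i)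
    (hc : ∃ i ∈ s, c i ≠ 0) :
    ∃ i0 ∈ s, c i0 ≠ 0 ∧ v (∑ i ∈ s, c i • x i) ^ M = α ^ w i0 ∧
      ∀ i ∈ s, c i ≠ 0 → w i ≤ w i0 := by
  classical
  obtain ⟨i1, hi1, hci1⟩ := hc
  obtain ⟨i0, hi0, hmax⟩ := Finset.exists_max_image (s.filter (fun i => c i ≠ 0)) w
    ⟨i1, Finset.mem_filter.2 ⟨hi1, hci1⟩⟩
  rw [Finset.mem_filter] at hi0
  refine ⟨i0, hi0.1, hi0.2, ?_, fun i hi hci => hmax i (Finset.mem_filter.2 ⟨hi, hci⟩)⟩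
  have hterm : ∀ i ∈ s, c i ≠ 0 → v (c i • x i) ^ M = α ^ w i := by
    intro i hi hci
    rw [Algebra.smul_def, map_mul, hv _ hci, one_mul, hx i hi]
  have hα0 : (0 : Γ) < α := lt_trans zero_lt_one hα
  have : v (∑ i ∈ s, c i • x i) = v (c i0 • x i0) := by
    apply Valuation.map_sum_eq_of_lt (j := i0) _ hi0.1
    · intro i hi
      rw [Finset.mem_sdiff, Finset.mem_singleton] at hi
      have h0 : v (c i0 • x i0) ^ M = α ^ w i0 := hterm i0 hi0.1 hi0.2
      by_cases hci : c i = 0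
      · rw [hci, zero_smul, map_zero, zero_lt_iff]
        intro h
        rw [h, zero_pow hM] at h0
        exact (pow_pos hα0 _).ne h0
      · apply lt_of_pow_lt_pow_left₀ M zero_le
        rw [hterm i hi.1 hci, h0]
        apply pow_lt_pow_right₀ hα
        rcases (hmax i (Finset.mem_filter.2 ⟨hi.1, hci⟩)).lt_or_eq with h | h
        · exact h
        · exact absurd (hw i hi.1 i0 hi0.1 h) hi.2
  rw [this, hterm i0 hi0.1 hi0.2]

lemma val_y (v : Valuation K Γ) (a : K) (ha : 1 < v a) (q m : ℕ) (hq : 2 ≤ q) (y : ℕ → K)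
    (hy0 : y 0 = 1) (hy : ∀ i, y (i + 1) ^ q - y (i + 1) = - (a * y i)) (i : ℕ) (hi : i < m) :
    1 < v (y (i + 1)) ∧ v (y (i + 1)) ^ (q ^ m) = v a ^ wt q m i := by
  have step : ∀ i, 1 ≤ v (y i) → 1 < v (y (i + 1)) ∧ v (y (i + 1)) ^ q = v a * v (y i) := by
    intro i h
    have h1 : v (y (i + 1) ^ q - y (i + 1)) = v a * v (y i) := by
      rw [hy, Valuation.map_neg, map_mul]
    have h2 : 1 < v a * v (y i) := lt_of_lt_of_le ha (le_mul_of_one_le_right' h)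
    have h3 : 1 < v (y (i + 1)) := by
      by_contra hcon
      push Not at hcon
      have : v (y (i + 1) ^ q - y (i + 1)) ≤ 1 := by
        apply Valuation.map_sub_le
        · rw [map_pow]; exact pow_le_one₀ zero_le hcon
        · exact hcon
      rw [h1] at this
      exact absurd h2 (not_lt.2 this)
    refine ⟨h3, ?_⟩
    rw [← h1, Valuation.map_sub_eq_of_lt_left, map_pow]
    rw [map_pow]
    calc v (y (i + 1)) = v (y (i + 1)) ^ 1 := (pow_one _).symm
      _ < v (y (i + 1)) ^ q := pow_lt_pow_right₀ h3 (by omega)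
  have hge : ∀ i, 1 ≤ v (y i) := by
    intro i
    induction i with
    | zero => simp [hy0]
    | succ i ih => exact (step i ih).1.le
  refine ⟨(step i (hge i)).1, ?_⟩
  have key : ∀ i, v (y (i + 1)) ^ (q ^ (i + 1)) = v a ^ (∑ l ∈ Finset.range (i + 1), q ^ l) := by
    intro i
    induction i with
    | zero => simp [(step 0 (hge 0)).2, hy0]
    | succ i ih =>
      rw [pow_succ', pow_mul, (step (i + 1) (hge _)).2, mul_pow, ih, ← pow_add,
        Finset.sum_range_succ _ (i + 1), add_comm]
  have : q ^ m = q ^ (i + 1) * q ^ (m - 1 - i) := by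
    rw [← pow_add]; congr 1; omega
  rw [this, pow_mul, key, ← pow_mul, wt, mul_comm]

lemma val_mono (v : Valuation K Γ) (a : K) (ha : 1 < v a) (q m : ℕ) (hq : 2 ≤ q) (y : ℕ → K)
    (hy0 : y 0 = 1) (hy : ∀ i, y (i + 1) ^ q - y (i + 1) = - (a * y i)) (e : ℕ → ℕ) :
    v (mono m y e) ^ (q ^ m) = v a ^ W q m e := by
  unfold mono W
  rw [map_prod, ← Finset.prod_pow, ← Finset.prod_pow_eq_pow_sum]
  apply Finset.prod_congr rfl
  intro i hi
  rw [map_pow, ← pow_mul, mul_comm, pow_mul,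
    (val_y v a ha q m hq y hy0 hy i (Finset.mem_range.1 hi)).2, ← pow_mul, mul_comm]

lemma wt_mono (q m : ℕ) (i j : ℕ) (hj : j < m) (hij : i ≤ j) : wt q m i ≤ wt q m j := by
  unfold wt
  have h1 : q ^ (m - 1 - i) * ∑ l ∈ Finset.range (i + 1), q ^ l
      = q ^ (m - 1 - j) * ∑ l ∈ Finset.range (i + 1), q ^ (l + (j - i)) := by
    rw [show m - 1 - i = (m - 1 - j) + (j - i) by omega, pow_add, mul_assoc]
    congr 1
    rw [Finset.mul_sum]
    apply Finset.sum_congr rfl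
    intro l _
    rw [pow_add, mul_comm]
  rw [h1]
  apply Nat.mul_le_mul_left
  have : j + 1 = (j - i) + (i + 1) := by omega
  rw [this]
  calc _ = ∑ l ∈ Finset.range (i + 1), q ^ ((j - i) + l) := by
        apply Finset.sum_congr rfl; intro l _; rw [add_comm]
    _ ≤ _ := by
      rw [Finset.sum_range_add _ (j - i)]
      exact Nat.le_add_left _ _

lemma exists_gen (k : Type*) [Field k] [IsAlgClosed k] (q : ℕ) (hq : 2 ≤ q) :
    ∃ (a : AlgebraicClosure (FractionRing (Polynomial k)))
      (B : ValuationSubring (AlgebraicClosure (FractionRing (Polynomial k))))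
      (y : ℕ → AlgebraicClosure (FractionRing (Polynomial k))),
      1 < B.valuation a ∧ (∀ c : k, c ≠ 0 →
        B.valuation (algebraMap k (AlgebraicClosure (FractionRing (Polynomial k))) c) = 1) ∧
      y 0 = 1 ∧ (∀ i, y (i + 1) ^ q - y (i + 1) = - (a * y i)) := by
  classical
  set K := AlgebraicClosure (FractionRing (Polynomial k)) with hK
  let φ : Polynomial k →+* K := algebraMap (Polynomial k) K
  have hφ : Function.Injective φ := by
    change Function.Injective (algebraMap (Polynomial k) K)
    rw [IsScalarTower.algebraMap_eq (Polynomial k) (FractionRing (Polynomial k)) K]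
    exact (algebraMap (FractionRing (Polynomial k)) K).injective.comp
      (IsFractionRing.injective (Polynomial k) (FractionRing (Polynomial k)))
  let A : Subring K := φ.range
  let e : Polynomial k ≃+* A := RingEquiv.ofBijective φ.rangeRestrict
    ⟨fun x y h => hφ (congrArg Subtype.val h), φ.rangeRestrict_surjective⟩
  let I : Ideal A := (Ideal.span {(Polynomial.X : Polynomial k)}).map e
  have hI : I ≠ ⊤ := by
    intro h
    have h1 : (Ideal.span {(Polynomial.X : Polynomial k)}) = ⊤ := by
      rw [← Ideal.comap_map_of_bijective (e : Polynomial k →+* A) e.bijective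
        (I := Ideal.span {(Polynomial.X : Polynomial k)})]
      change Ideal.comap _ I = ⊤
      rw [h, Ideal.comap_top]
    rw [Ideal.span_singleton_eq_top] at h1
    exact Polynomial.not_isUnit_X h1
  obtain ⟨B, hB, hB2⟩ := Ideal.image_subset_nonunits_valuationSubring I hI
  have hX : B.valuation (φ Polynomial.X) < 1 := by
    apply (ValuationSubring.mem_nonunits_iff B).1
    apply hB2
    exact ⟨e Polynomial.X, Ideal.mem_map_of_mem _ (Ideal.subset_span rfl), rfl⟩
  have hX0 : φ Polynomial.X ≠ 0 := by
    rw [Ne, map_eq_zero_iff φ hφ]; exact Polynomial.X_ne_zero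
  have hc : ∀ c : k, B.valuation (algebraMap k K c) ≤ 1 := by
    intro c
    rw [ValuationSubring.valuation_le_one_iff]
    apply hB
    refine ⟨Polynomial.C c, ?_⟩
    change algebraMap (Polynomial k) K (algebraMap k (Polynomial k) c) = _
    rw [← IsScalarTower.algebraMap_apply k (Polynomial k) K]
  have hroot : ∀ b : K, ∃ x : K, x ^ q - x = b := by
    intro b
    obtain ⟨x, hx⟩ := IsAlgClosed.exists_root
      (Polynomial.X ^ q - Polynomial.X - Polynomial.C b : Polynomial K) (by
        rw [sub_sub]
        rw [Polynomial.degree_sub_eq_left_of_degree_lt]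
        · rw [Polynomial.degree_X_pow]; exact_mod_cast (by omega : q ≠ 0)
        · rw [Polynomial.degree_X_pow, Polynomial.degree_X_add_C]; exact_mod_cast hq)
    refine ⟨x, ?_⟩
    simp [Polynomial.IsRoot] at hx
    linear_combination hx
  choose rt hrt using hroot
  refine ⟨(φ Polynomial.X)⁻¹, B,
    fun n => Nat.rec 1 (fun _ z => rt (-((φ Polynomial.X)⁻¹ * z))) n, ?_, ?_, rfl, ?_⟩
  · rw [map_inv₀, one_lt_inv₀ (zero_lt_iff.2 ((Valuation.ne_zero_iff _).2 hX0))]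
    exact hX
  · intro c hc0
    apply le_antisymm (hc c)
    have := hc c⁻¹
    rw [map_inv₀, map_inv₀, inv_le_one₀] at this
    · exact this
    · rw [zero_lt_iff, Valuation.ne_zero_iff]
      exact (_root_.map_ne_zero _).2 hc0
  · intro i
    exact hrt _

end Val
end Step


set_option linter.unusedSectionVars false
set_option linter.style.haveILetI false

namespace Step

structure Gen (k : Type*) {K Γ : Type*} [Field k] [Field K] [Algebra k K]
    [LinearOrderedCommGroupWithZero Γ] (q m : ℕ) (v : Valuation K Γ) (a : K) (y : ℕ → K) : Prop where
  hq : 2 ≤ q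
  hm : 1 ≤ m
  ha : 1 < v a
  hv : ∀ c : k, c ≠ 0 → v (algebraMap k K c) = 1
  hy0 : y 0 = 1
  hy : ∀ i, y (i + 1) ^ q - y (i + 1) = - (a * y i)

structure Pts {k ι : Type*} [Field k] (q m : ℕ) (z : ι → ℕ → k) : Prop where
  h0 : ∀ i, z i 0 = 1
  hr : ∀ i l, z i (l + 1) ^ q = z i (l + 1) + (z i 1 ^ q - z i 1) * z i l
  hd : ∀ i j, i ≠ j → ∃ l < m, z i (l + 1) ≠ z j (l + 1)

section Main

variable {k K Γ ι : Type*} [Field k] [Field K] [Algebra k K] [LinearOrderedCommGroupWithZero Γ]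
  {q m : ℕ} {v : Valuation K Γ} {a : K} {y : ℕ → K} {z : ι → ℕ → k}

def YY (y : ℕ → K) (z : ι → ℕ → k) (n : ℕ) : K × (ι → k) := (y n, fun i => z i n)

lemma mono_fst (e : ℕ → ℕ) : (mono m (YY y z) e).1 = mono m y e := by
  simp [mono, YY, Prod.fst_prod]

lemma mono_snd (e : ℕ → ℕ) (i : ι) : (mono m (YY y z) e).2 i = mono m (z i) e := by
  simp [mono, YY, Prod.snd_prod]

lemma YY_rel (G : Gen k q m v a y) (P : Pts q m z) (i : ℕ) :
    YY y z (i + 1) ^ q = YY y z (i + 1) + (YY y z 1 ^ q - YY y z 1) * YY y z i := by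
  ext j
  · simp only [YY, Prod.pow_fst, Prod.fst_add, Prod.fst_mul, Prod.fst_sub]
    have h1 := G.hy i
    have h2 := G.hy 0
    rw [G.hy0] at h2
    linear_combination h1 - y i * h2
  · simp only [YY, Prod.pow_snd, Prod.snd_add, Prod.snd_mul, Prod.snd_sub, Pi.pow_apply,
      Pi.add_apply, Pi.mul_apply, Pi.sub_apply]
    exact P.hr j i

open Classical in
noncomputable def gg (q m : ℕ) (y : ℕ → K) (z : ι → ℕ → k) (D : ℕ) : K × (ι → k) :=
  if h : ∃ e, Red q m e ∧ W q m e = D then mono m (YY y z) h.choose else 0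

lemma gg_eq (hq : 2 ≤ q) (hm : 1 ≤ m) (e : ℕ → ℕ) (he : Red q m e) :
    gg q m y z (W q m e) = mono m (YY y z) e := by
  have h : ∃ e', Red q m e' ∧ W q m e' = W q m e := ⟨e, he, rfl⟩
  unfold gg
  rw [dif_pos h, W_inj q (by omega) m hm _ e h.choose_spec.1 he h.choose_spec.2]

def ND (q m : ℕ) (y : ℕ → K) (z : ι → ℕ → k) (D : ℕ) : Submodule k (K × (ι → k)) :=
  Submodule.span k (Set.range (fun i : Fin (D + 1) => gg q m y z i))

lemma ND_fin (D : ℕ) : Module.Finite k (ND q m y z D) := by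
  unfold ND; exact Module.Finite.span_of_finite k (Set.finite_range _)

lemma ND_rank (D : ℕ) : Module.finrank k (ND q m y z D) ≤ D + 1 := by
  have := finrank_range_le_card (R := k) (fun i : Fin (D + 1) => gg q m y z i)
  rw [Fintype.card_fin] at this
  exact this

lemma mono_mem_ND (hq : 2 ≤ q) (hm : 1 ≤ m) (e : ℕ → ℕ) (he : Red q m e) (D : ℕ)
    (h : W q m e ≤ D) : mono m (YY y z) e ∈ ND q m y z D := by
  rw [← gg_eq hq hm e he]
  exact Submodule.subset_span ⟨⟨W q m e, by omega⟩, rfl⟩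

lemma NN_repr (x : K × (ι → k)) (hx : x ∈ NN k q m (YY y z)) :
    ∃ c : {e // Red q m e} →₀ k, x = ∑ e ∈ c.support, c e • mono m (YY y z) e.1 := by
  have : NN k q m (YY y z) = Submodule.span k
      (Set.range (fun e : {e // Red q m e} => mono m (YY y z) e.1)) := by
    unfold NN
    congr 1
    ext x
    constructor
    · rintro ⟨e, he, rfl⟩; exact ⟨⟨e, he⟩, rfl⟩
    · rintro ⟨e, rfl⟩; exact ⟨e.1, e.2, rfl⟩
  rw [this, Finsupp.mem_span_range_iff_exists_finsupp] at hx
  obtain ⟨c, hc⟩ := hx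
  exact ⟨c, hc.symm⟩

lemma NN_val (G : Gen k q m v a y) (x : K × (ι → k)) (hx : x ∈ NN k q m (YY y z)) (hx0 : x ≠ 0) :
    ∃ D, v x.1 ^ (q ^ m) = v a ^ D ∧ x ∈ ND q m y z D := by
  obtain ⟨c, hc⟩ := NN_repr x hx
  have hne : c.support.Nonempty := by
    rw [Finset.nonempty_iff_ne_empty]
    intro h
    rw [h, Finset.sum_empty] at hc
    exact hx0 hc
  obtain ⟨e1, he1⟩ := hne
  have hq := G.hq
  obtain ⟨e0, he0, hce0, hval, hmax⟩ := val_sum v G.hv (v a) G.ha (q ^ m) (by positivity)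
    c.support (fun e => mono m y e.1) c (fun e => W q m e.1)
    (fun i _ j _ h => Subtype.ext (W_inj q (by omega) m G.hm _ _ i.2 j.2 h))
    (fun i _ => val_mono v a G.ha q m G.hq y G.hy0 G.hy i.1)
    ⟨e1, he1, Finsupp.mem_support_iff.1 he1⟩
  refine ⟨W q m e0.1, ?_, ?_⟩
  · rw [← hval, hc]
    congr 2
    rw [Prod.fst_sum]
    apply Finset.sum_congr rfl
    intro e _
    rw [Prod.smul_fst, mono_fst]
  · rw [hc]
    apply Submodule.sum_mem
    intro e he
    apply Submodule.smul_mem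
    exact mono_mem_ND G.hq G.hm _ e.2 _ (hmax e he (Finsupp.mem_support_iff.1 he))

lemma NN_zero (G : Gen k q m v a y) (x : K × (ι → k)) (hx : x ∈ NN k q m (YY y z)) (h : x.1 = 0) :
    x = 0 := by
  by_contra hx0
  obtain ⟨D, hD, _⟩ := NN_val G x hx hx0
  rw [h, map_zero, zero_pow (pow_ne_zero _ (by have := G.hq; omega))] at hD
  exact (pow_pos (lt_trans zero_lt_one G.ha) D).ne hD

lemma ND_mono {D D' : ℕ} (h : D ≤ D') : ND q m y z D ≤ ND q m y z D' := by
  unfold ND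
  apply Submodule.span_mono
  rintro _ ⟨i, rfl⟩
  exact ⟨⟨i.1, by omega⟩, rfl⟩

lemma mem_ND (G : Gen k q m v a y) (x : K × (ι → k)) (hx : x ∈ NN k q m (YY y z)) (D : ℕ)
    (h : v x.1 ^ (q ^ m) ≤ v a ^ D) : x ∈ ND q m y z D := by
  by_cases hx0 : x = 0
  · rw [hx0]; exact Submodule.zero_mem _
  obtain ⟨D', hD', hmem⟩ := NN_val G x hx hx0
  rw [hD'] at h
  exact ND_mono ((pow_le_pow_iff_right₀ G.ha).1 h) hmem

lemma exists_D (G : Gen k q m v a y) (x : K × (ι → k)) (hx : x ∈ NN k q m (YY y z)) :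
    ∃ D, x ∈ ND q m y z D := by
  by_cases hx0 : x = 0
  · exact ⟨0, by rw [hx0]; exact Submodule.zero_mem _⟩
  obtain ⟨D', _, hmem⟩ := NN_val G x hx hx0
  exact ⟨D', hmem⟩

lemma mono_mem_NN (e : ℕ → ℕ) (he : Red q m e) : mono m (YY y z) e ∈ NN k q m (YY y z) :=
  Submodule.subset_span ⟨e, he, rfl⟩

lemma Y_mem (G : Gen k q m v a y) (P : Pts q m z) (i : ℕ) (hi : i ≤ m) :
    YY y z i ∈ NN k q m (YY y z) := by
  rcases i with _ | i
  · have : YY y z 0 = 1 := by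
      ext j
      · simp [YY, G.hy0]
      · simp [YY, P.h0]
    rw [this]; exact NN_one q m G.hq _
  · have := NN_mul_Y (k := k) q m G.hq G.hm (YY y z) (YY_rel G P) i (by omega) 1 (NN_one q m G.hq _)
    simpa using this

lemma NN_prod (G : Gen k q m v a y) (P : Pts q m z) {κ : Type*} (s : Finset κ)
    (f : κ → K × (ι → k)) (h : ∀ j ∈ s, f j ∈ NN k q m (YY y z)) :
    ∏ j ∈ s, f j ∈ NN k q m (YY y z) := by
  classical
  induction s using Finset.induction_on with
  | empty => simpa using NN_one q m G.hq _
  | insert b s hb ih =>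
    rw [Finset.prod_insert hb]
    exact NN_mul q m G.hq G.hm _ (YY_rel G P) _ _ (h b (Finset.mem_insert_self _ _))
      (ih fun j hj => h j (Finset.mem_insert_of_mem hj))

lemma NN_powm (G : Gen k q m v a y) (P : Pts q m z) (x : K × (ι → k))
    (h : x ∈ NN k q m (YY y z)) (n : ℕ) : x ^ n ∈ NN k q m (YY y z) := by
  have := NN_prod G P (Finset.range n) (fun _ => x) (fun _ _ => h)
  simpa using this

lemma exists_delta [Fintype ι] [DecidableEq ι] (G : Gen k q m v a y) (P : Pts q m z) (i : ι) :
    ∃ x ∈ NN k q m (YY y z), ∀ j, x.2 j = if i = j then 1 else 0 := by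
  have h1 : ∀ j, ∃ x ∈ NN k q m (YY y z), i ≠ j → x.2 j = 0 ∧ x.2 i = 1 := by
    intro j
    by_cases hij : i = j
    · exact ⟨0, Submodule.zero_mem _, fun h => absurd hij h⟩
    · obtain ⟨l, hl, hne⟩ := P.hd i j hij
      refine ⟨(z i (l + 1) - z j (l + 1))⁻¹ • (YY y z (l + 1) - z j (l + 1) • (1 : K × (ι → k))),
        ?_, fun _ => ⟨?_, ?_⟩⟩
      · apply Submodule.smul_mem
        apply Submodule.sub_mem
        · exact Y_mem G P _ (by omega)
        · exact Submodule.smul_mem _ _ (NN_one q m G.hq _)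
      · simp [YY]
      · simp [YY, inv_mul_cancel₀ (sub_ne_zero.2 hne)]
  choose x hx hx2 using h1
  refine ⟨∏ j ∈ Finset.univ.erase i, x j, NN_prod G P _ _ (fun j _ => hx j), ?_⟩
  intro j
  rw [Prod.snd_prod, Finset.prod_apply]
  by_cases hij : i = j
  · subst hij
    rw [if_pos rfl]
    apply Finset.prod_eq_one
    intro l hl
    exact (hx2 l (Finset.ne_of_mem_erase hl).symm).2
  · rw [if_neg hij]
    apply Finset.prod_eq_zero (i := j)
    · exact Finset.mem_erase.2 ⟨fun h => hij h.symm, Finset.mem_univ _⟩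
    · exact (hx2 j hij).1

lemma zeros_le [Fintype ι] (G : Gen k q m v a y) (P : Pts q m z) (c : ℕ)
    (hc : ∀ D, c ≤ D → ∃ e, Red q m e ∧ W q m e = D) (H : K × (ι → k))
    (hH : H ∈ NN k q m (YY y z)) (hH0 : H.1 ≠ 0) (d : ℕ) (hd : v H.1 ^ (q ^ m) ≤ v a ^ d)
    (hz : H.2 = 0) : Fintype.card ι ≤ d + c := by
  classical
  choose δ hδ hδ2 using fun i => exists_delta G P i
  choose Dd hDd using fun i => exists_D G (δ i) (hδ i)
  choose e he heW using hc
  set D := d + c + ∑ i, Dd i with hD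
  have hDi : ∀ i, δ i ∈ ND q m y z D := by
    intro i
    refine ND_mono ?_ (hDd i)
    have := Finset.single_le_sum (f := Dd) (fun _ _ => Nat.zero_le _) (Finset.mem_univ i)
    omega
  set n := D - d - c + 1 with hn
  let μ : Fin n → K × (ι → k) := fun t => H * mono m (YY y z) (e (c + t) (by omega))
  have hμN : ∀ t, μ t ∈ NN k q m (YY y z) := fun t =>
    NN_mul q m G.hq G.hm _ (YY_rel G P) _ _ hH (mono_mem_NN _ (he _ _))
  have hμ : ∀ t, μ t ∈ ND q m y z D := by
    intro t
    apply mem_ND G _ (hμN t)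
    change v (H.1 * (mono m (YY y z) _).1) ^ _ ≤ _
    rw [mono_fst, map_mul, mul_pow, val_mono v a G.ha q m G.hq y G.hy0 G.hy, heW]
    calc _ ≤ v a ^ d * v a ^ (c + (t : ℕ)) := by gcongr
      _ = v a ^ (d + (c + t)) := by simp only [pow_add]
      _ ≤ v a ^ D := pow_le_pow_right₀ G.ha.le (by have := t.2; omega)
  let fam : ι ⊕ Fin n → ND q m y z D := Sum.elim (fun i => ⟨δ i, hDi i⟩) (fun t => ⟨μ t, hμ t⟩)
  have hli : LinearIndependent k fam := by
    rw [Fintype.linearIndependent_iff]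
    intro g hg
    have hg' : ∑ i, g (Sum.inl i) • δ i + ∑ t, g (Sum.inr t) • μ t = 0 := by
      have := congrArg (Subtype.val) hg
      simpa [fam, Fintype.sum_sum_type] using this
    have hl : ∀ j, g (Sum.inl j) = 0 := by
      intro j
      have := congrArg (fun x : K × (ι → k) => x.2 j) hg'
      simp only [Prod.snd_add, Prod.snd_sum, Pi.add_apply, Finset.sum_apply, Prod.smul_snd,
        Pi.smul_apply, hδ2, μ, Prod.snd_mul, hz] at this
      simpa using this
    have h2 : ∑ t, g (Sum.inr t) • μ t = 0 := by
      simpa [hl] using hg'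
    have hr : ∀ t, g (Sum.inr t) = 0 := by
      by_contra hcon
      push Not at hcon
      obtain ⟨t0, ht0⟩ := hcon
      obtain ⟨t1, _, _, hv1, _⟩ := val_sum v G.hv (v a) G.ha (q ^ m)
        (pow_ne_zero _ (by have := G.hq; omega)) Finset.univ
        (fun t : Fin n => mono m y (e (c + t) (by omega))) (fun t => g (Sum.inr t))
        (fun t => c + t) (fun i _ j _ h => Fin.ext (by omega))
        (fun t _ => by rw [val_mono v a G.ha q m G.hq y G.hy0 G.hy, heW])
        ⟨t0, Finset.mem_univ _, ht0⟩
      have h3 := congrArg Prod.fst h2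
      rw [Prod.fst_sum] at h3
      have h4 : H.1 * ∑ t : Fin n, g (Sum.inr t) • mono m y (e (c + t) (by omega)) = 0 := by
        rw [Finset.mul_sum, ← Prod.fst_zero (M := K) (N := ι → k), ← h3]
        apply Finset.sum_congr rfl
        intro t _
        rw [Prod.smul_fst, mul_smul_comm]
        simp [μ, mono_fst]
      rcases mul_eq_zero.1 h4 with h5 | h5
      · exact hH0 h5
      · rw [h5, map_zero, zero_pow (pow_ne_zero _ (by have := G.hq; omega))] at hv1
        exact (pow_pos (lt_trans zero_lt_one G.ha) _).ne hv1
    rintro (j | t)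
    · exact hl j
    · exact hr t
  haveI := ND_fin (k := k) (q := q) (m := m) (y := y) (z := z) D
  have h1 := hli.fintype_card_le_finrank
  have h2 := ND_rank (k := k) (q := q) (m := m) (y := y) (z := z) D
  rw [Fintype.card_sum, Fintype.card_fin] at h1
  omega

end Main
end Step

set_option linter.unusedSectionVars false
namespace Step

section Fin

lemma frob_sum {A ι : Type*} [CommSemiring A] (p n R : ℕ) [ExpChar A p] (hR : R = p ^ n) (s : Finset ι)
    (w : ι → A) : (∑ i ∈ s, w i) ^ R = ∑ i ∈ s, w i ^ R := by
  subst hR; exact sum_pow_char_pow p _ _ _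

variable {k K Γ ι : Type*} [Field k] [Field K] [Algebra k K] [LinearOrderedCommGroupWithZero Γ]
  {q m : ℕ} {v : Valuation K Γ} {a : K} {y : ℕ → K} {z : ι → ℕ → k}

def tw (m : ℕ) (g : ℕ → k) (y : ℕ → K) (z : ι → ℕ → k) (e : ℕ → ℕ) : K × (ι → k) :=
  ∏ l ∈ Finset.range m, (∑ j ∈ Finset.range (l + 2), g j • YY y z (l + 1 - j)) ^ e l

lemma tw_mem (G : Gen k q m v a y) (P : Pts q m z) (g : ℕ → k) (e : ℕ → ℕ) :
    tw m g y z e ∈ NN k q m (YY y z) := by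
  apply NN_prod G P
  intro l hl
  rw [Finset.mem_range] at hl
  apply NN_powm G P
  apply Submodule.sum_mem
  intro j _
  exact Submodule.smul_mem _ _ (Y_mem G P _ (by omega))

lemma val_le_one (G : Gen k q m v a y) (c : k) : v (algebraMap k K c) ≤ 1 := by
  by_cases h : c = 0
  · rw [h, map_zero, map_zero]; exact zero_le
  · exact (G.hv c h).le

lemma val_tw (G : Gen k q m v a y) (g : ℕ → k) (e : ℕ → ℕ) :
    v (tw m g y z e).1 ^ (q ^ m) ≤ v a ^ W q m e := by
  have hq := G.hq
  have hqm : q ^ m ≠ 0 := pow_ne_zero _ (by omega)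
  unfold tw W
  rw [Prod.fst_prod, map_prod, ← Finset.prod_pow, ← Finset.prod_pow_eq_pow_sum]
  apply Finset.prod_le_prod'
  intro l hl
  rw [Finset.mem_range] at hl
  rw [Prod.pow_fst, map_pow, ← pow_mul, mul_comm, pow_mul, mul_comm (e l), pow_mul]
  apply pow_le_pow_left₀ zero_le
  have h2 := val_y v a G.ha q m G.hq y G.hy0 G.hy l hl
  rw [← h2.2]
  apply pow_le_pow_left₀ zero_le
  rw [Prod.fst_sum]
  apply Valuation.map_sum_le
  intro j _
  rw [Prod.smul_fst, Algebra.smul_def, map_mul]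
  apply le_trans (mul_le_of_le_one_left' (val_le_one G _))
  change v (y (l + 1 - j)) ≤ _
  rcases h : l + 1 - j with _ | i
  · rw [G.hy0, map_one]; exact h2.1.le
  · have h3 := val_y v a G.ha q m G.hq y G.hy0 G.hy i (by omega)
    apply le_of_pow_le_pow_left₀ hqm zero_le
    rw [h3.2, h2.2]
    exact pow_le_pow_right₀ G.ha.le (wt_mono q m i l hl (by omega))

lemma tw_snd (g : ℕ → k) (e : ℕ → ℕ) (Q : ℕ) (i : ι)
    (hz : ∀ l < m, z i (l + 1) ^ Q = ∑ j ∈ Finset.range (l + 2), g j * z i (l + 1 - j)) :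
    (tw m g y z e).2 i = mono m (z i) e ^ Q := by
  unfold tw mono
  rw [Prod.snd_prod, Finset.prod_apply, ← Finset.prod_pow]
  apply Finset.prod_congr rfl
  intro l hl
  rw [← pow_mul, mul_comm, pow_mul, hz l (Finset.mem_range.1 hl)]
  simp [Prod.snd_sum, YY]

lemma stepanov_aux [Fintype ι] [IsAlgClosed k] (p : ℕ) [ExpChar k p] (f : ℕ) (hqp : q = p ^ f)
    (G : Gen k q m v a y) (P : Pts q m z) (c : ℕ)
    (hc : ∀ D, c ≤ D → ∃ e, Red q m e ∧ W q m e = D) (h : ℕ) (hR : c * c + 3 * c + 1 < q ^ h)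
    (g : ℕ → k) (hz : ∀ i, ∀ l < m, z i (l + 1) ^ (q ^ (2 * h)) =
      ∑ j ∈ Finset.range (l + 2), g j * z i (l + 1 - j)) :
    Fintype.card ι ≤ q ^ (2 * h) + (3 * c + 1) * q ^ h := by
  classical
  choose e he heW using hc
  set R := q ^ h with hRdef
  have hQ : q ^ (2 * h) = R * R := by rw [hRdef, ← pow_add]; congr 1; omega
  rw [hQ] at hz ⊢
  have hq := G.hq
  set M := q ^ m with hM
  have hM0 : M ≠ 0 := pow_ne_zero _ (by omega)
  set B := R + c + 1 with hB
  let S := Fin (R - c) × Fin B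
  let es : S → ℕ → ℕ := fun t => e (c + t.1) (by omega)
  let et : S → ℕ → ℕ := fun t => e (c + t.2) (by omega)
  have hes : ∀ t, W q m (es t) = c + t.1 := fun t => heW _ _
  have het : ∀ t, W q m (et t) = c + t.2 := fun t => heW _ _
  let F : S → K × (ι → k) := fun t => mono m (YY y z) (es t) ^ R * tw m g y z (et t)
  have hFN : ∀ t, F t ∈ NN k q m (YY y z) := fun t =>
    NN_mul q m G.hq G.hm _ (YY_rel G P) _ _ (NN_powm G P _ (mono_mem_NN _ (he _ _)) _)
      (tw_mem G P g _)
  set D := (R - 1) * R + (c + B - 1) with hD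
  have hFD : ∀ t, F t ∈ ND q m y z D := by
    intro t
    apply mem_ND G _ (hFN t)
    change v ((mono m (YY y z) (es t) ^ R).1 * (tw m g y z (et t)).1) ^ M ≤ _
    rw [Prod.pow_fst, mono_fst, map_mul, mul_pow, map_pow, ← pow_mul, mul_comm R, pow_mul,
      val_mono v a G.ha q m G.hq y G.hy0 G.hy]
    calc _ ≤ (v a ^ W q m (es t)) ^ R * v a ^ W q m (et t) := by
            exact mul_le_mul' le_rfl (val_tw G g _)
      _ = v a ^ (W q m (es t) * R + W q m (et t)) := by rw [← pow_mul, ← pow_add]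
      _ ≤ v a ^ D := by
        apply pow_le_pow_right₀ G.ha.le
        rw [hes, het]
        have h1 := t.1.2
        have h2 := t.2.2
        have h3 : (c + (t.1 : ℕ)) * R ≤ (R - 1) * R := Nat.mul_le_mul_right _ (by omega)
        omega
  have hdep : ∃ d : S → k, ∑ t, d t • F t = 0 ∧ ∃ t, d t ≠ 0 := by
    by_contra hcon
    push Not at hcon
    have hli : LinearIndependent k (fun t : S => (⟨F t, hFD t⟩ : ND q m y z D)) := by
      rw [Fintype.linearIndependent_iff]
      intro d hd
      apply hcon d
      have := congrArg Subtype.val hd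
      simpa using this
    have := ND_fin (k := k) (q := q) (m := m) (y := y) (z := z) D
    have h1 := hli.fintype_card_le_finrank
    have h2 := ND_rank (k := k) (q := q) (m := m) (y := y) (z := z) D
    rw [Fintype.card_prod, Fintype.card_fin, Fintype.card_fin] at h1
    have h3 := h1.trans h2
    obtain ⟨x, hx⟩ := Nat.exists_eq_add_of_lt hR
    have hx1 : R - c = c * c + 2 * c + 2 + x := by omega
    have hx2 : R - 1 = c * c + 3 * c + 1 + x := by omega
    have hx3 : c + B - 1 = R + 2 * c := by omega
    rw [hD, hx1, hx2, hx3, hB] at h3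
    rw [hx] at h3
    nlinarith
  obtain ⟨d, hd0, t0, ht0⟩ := hdep
  have hRpos : 0 < R := by omega
  choose d' hd' using fun t => IsAlgClosed.exists_pow_nat_eq (d t) hRpos
  let H : K × (ι → k) := ∑ t, d' t • (mono m (YY y z) (es t) * mono m (YY y z) (et t) ^ R)
  have hHN : H ∈ NN k q m (YY y z) := by
    apply Submodule.sum_mem
    intro t _
    apply Submodule.smul_mem
    exact NN_mul q m G.hq G.hm _ (YY_rel G P) _ _ (mono_mem_NN _ (he _ _))
      (NN_powm G P _ (mono_mem_NN _ (he _ _)) _)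
  have hH1 : H.1 = ∑ t, d' t • (mono m y (es t) * mono m y (et t) ^ R) := by
    simp [H, Prod.fst_sum, mono_fst]
  obtain ⟨t1, _, _, hv1, _⟩ := val_sum v G.hv (v a) G.ha M hM0 Finset.univ
    (fun t => mono m y (es t) * mono m y (et t) ^ R) d' (fun t => (c + t.1) + (c + t.2) * R)
    (by
      intro i _ j _ hij
      have h1 := i.1.2
      have h2 := j.1.2
      try simp only at hij
      have e1 : (c + (i.1 : ℕ)) = c + (j.1 : ℕ) := by
        have := congrArg (· % R) hij
        simpa [Nat.add_mul_mod_self_right, Nat.mod_eq_of_lt (show c + (i.1 : ℕ) < R by omega),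
          Nat.mod_eq_of_lt (show c + (j.1 : ℕ) < R by omega)] using this
      rw [e1] at hij
      have e2 := Nat.eq_of_mul_eq_mul_right hRpos (Nat.add_left_cancel hij)
      exact Prod.ext (Fin.ext (by omega)) (Fin.ext (by omega)))
    (by
      intro t _
      rw [map_mul, mul_pow, map_pow, ← pow_mul (v (mono m y (et t))), mul_comm R, pow_mul,
        val_mono v a G.ha q m G.hq y G.hy0 G.hy, val_mono v a G.ha q m G.hq y G.hy0 G.hy,
        hes, het, ← pow_mul, ← pow_add])
    ⟨t0, Finset.mem_univ _, fun h => ht0 (by rw [← hd', h, zero_pow hRpos.ne'])⟩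
  rw [← hH1] at hv1
  have hH0 : H.1 ≠ 0 := by
    intro h
    rw [h, map_zero, zero_pow hM0] at hv1
    exact (pow_pos (lt_trans zero_lt_one G.ha) _).ne hv1
  have hH2 : H.2 = 0 := by
    funext i
    have h1 := congrArg (fun x : K × (ι → k) => x.2 i) hd0
    have hRp : R = p ^ (f * h) := by rw [hRdef, hqp, pow_mul]
    have h2 : (H.2 i) ^ R = 0 := by
      have : H.2 i = ∑ t, d' t * (mono m (z i) (es t) * mono m (z i) (et t) ^ R) := by
        simp [H, Prod.snd_sum, mono_snd]
      rw [this]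
      rw [frob_sum p (f * h) R hRp]
      simp only [Prod.snd_sum, Finset.sum_apply, Prod.smul_snd, Pi.smul_apply, F, Prod.snd_mul,
        Pi.mul_apply, Prod.pow_snd, Pi.pow_apply, mono_snd, Prod.snd_zero, Pi.zero_apply,
        tw_snd g _ (R * R) i (hz i), smul_eq_mul] at h1
      rw [← h1]
      apply Finset.sum_congr rfl
      intro t _
      rw [mul_pow, hd', mul_pow, ← pow_mul]
    exact pow_eq_zero_iff hRpos.ne' |>.1 h2
  have hfin := zeros_le G P c (fun D hD => ⟨e D hD, he D hD, heW D hD⟩) H hHN hH0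
    ((R - 1) + (c + B - 1) * R) (by
      rw [hv1]
      apply pow_le_pow_right₀ G.ha.le
      have h1 := t1.1.2
      have h2 := t1.2.2
      have h3 : (c + (t1.2 : ℕ)) * R ≤ (c + B - 1) * R := Nat.mul_le_mul_right _ (by omega)
      omega) hH2
  refine hfin.trans ?_
  have hx3 : c + B - 1 = R + 2 * c := by omega
  rw [hx3]
  have : R - 1 ≤ R := Nat.sub_le _ _
  nlinarith

end Fin

theorem stepanov.{u, v} (k : Type u) [Field k] [IsAlgClosed k] (p f q m : ℕ) [ExpChar k p]
    (hqp : q = p ^ f) (hq : 2 ≤ q) (hm : 1 ≤ m) :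
    ∃ C h0 : ℕ, ∀ h, h0 ≤ h → ∀ (ι : Type v) [Fintype ι] (z : ι → ℕ → k) (g : ℕ → k),
      Pts q m z → (∀ i, ∀ l < m, z i (l + 1) ^ (q ^ (2 * h)) =
        ∑ j ∈ Finset.range (l + 2), g j * z i (l + 1 - j)) →
      Fintype.card ι ≤ q ^ (2 * h) + C * q ^ h := by
  obtain ⟨a, B, y, ha, hv, hy0, hy⟩ := exists_gen k q hq
  obtain ⟨n, rfl⟩ : ∃ n, m = n + 1 := ⟨m - 1, by omega⟩
  obtain ⟨c, hc⟩ := W_surj q (by omega) n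
  refine ⟨3 * c + 1, c * c + 3 * c + 1, fun h hh ι _ z g P hz => ?_⟩
  exact stepanov_aux p f hqp ⟨hq, hm, ha, hv, hy0, hy⟩ P c hc h
    (lt_of_le_of_lt hh (Nat.lt_pow_self (by omega))) g hz

end Step

set_option linter.unusedSectionVars false
namespace Step

section Polys
variable (F : Type*) [Field F] [Fintype F]

lemma LtInj (d : ℕ) : Function.Injective (fun c => ((degreeLTEquiv F d).symm c : F[X])) :=
  fun _ _ h => (degreeLTEquiv F d).symm.injective (Subtype.ext h)

noncomputable def Lt (d : ℕ) : Finset F[X] := by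
  classical
  exact (Finset.univ : Finset (Fin d → F)).map
    ⟨fun c => ((degreeLTEquiv F d).symm c : F[X]), LtInj F d⟩

variable {F}
lemma mem_Lt {d : ℕ} {h : F[X]} : h ∈ Lt F d ↔ h.degree < d := by
  simp only [Lt, Finset.mem_map, Finset.mem_univ, true_and, Function.Embedding.coeFn_mk]
  constructor
  · rintro ⟨c, rfl⟩
    exact mem_degreeLT.1 ((degreeLTEquiv F d).symm c).2
  · intro hh
    exact ⟨degreeLTEquiv F d ⟨h, mem_degreeLT.2 hh⟩, by simp⟩

lemma card_Lt (d : ℕ) : (Lt F d).card = Fintype.card F ^ d := by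
  simp [Lt]

variable (F) in
noncomputable def Mon (d : ℕ) : Finset F[X] := (Lt F d).map (addLeftEmbedding (X ^ d))

lemma mem_Mon {d : ℕ} {h : F[X]} : h ∈ Mon F d ↔ h.Monic ∧ h.natDegree = d := by
  simp only [Mon, Finset.mem_map, addLeftEmbedding_apply, mem_Lt]
  constructor
  · rintro ⟨c, hc, rfl⟩
    exact ⟨monic_X_pow_add hc, by
      rw [natDegree_add_eq_left_of_degree_lt (by simpa using hc), natDegree_X_pow]⟩
  · rintro ⟨h1, h2⟩
    refine ⟨h - X ^ d, ?_, by ring⟩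
    have h3 : h.degree = d := by rw [degree_eq_natDegree h1.ne_zero, h2]
    rw [← h3]
    apply degree_sub_lt_left
    · rw [h3, degree_X_pow]
    · exact h1.ne_zero
    · rw [h1.leadingCoeff, leadingCoeff_X_pow]

lemma card_Mon (d : ℕ) : (Mon F d).card = Fintype.card F ^ d := by
  simp [Mon, card_Lt]

lemma Mon_zero : Mon F 0 = {1} := by
  ext h
  rw [mem_Mon, Finset.mem_singleton]
  constructor
  · rintro ⟨h1, h2⟩
    exact h1.natDegree_eq_zero.1 h2
  · rintro rfl; simp

end Polys

structure Ph (F : Type*) [Field F] (m : ℕ) (G : Type*) [AddCommGroup G] where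
  φ : F[X] → G
  mul : ∀ h h', h.Monic → h'.Monic → φ (h * h') = φ h + φ h'
  eq_iff : ∀ h h', h.Monic → h'.Monic → (φ h = φ h' ↔ ∀ i ≤ m, h.reverse.coeff i = h'.reverse.coeff i)
  surj : ∀ g, ∃ h, h.Monic ∧ h.natDegree = m ∧ φ h = g

section Ex
variable (F : Type*) [Field F] (m : ℕ)

noncomputable def UU : Subgroup (PowerSeries F)ˣ :=
  (Units.map (PowerSeries.constantCoeff (R := F)).toMonoidHom).ker
noncomputable def HH : Subgroup (UU F) :=
  ((Units.map (Ideal.Quotient.mk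
    (Ideal.span {(PowerSeries.X : PowerSeries F) ^ (m + 1)})).toMonoidHom).ker).subgroupOf (UU F)

variable {F}
lemma mem_UU (u : (PowerSeries F)ˣ) : u ∈ UU F ↔ PowerSeries.constantCoeff (R := F) u = 1 := by
  simp [UU, MonoidHom.mem_ker, Units.ext_iff]

lemma mem_HH (u : UU F) : u ∈ HH F m ↔ (PowerSeries.X : PowerSeries F) ^ (m+1) ∣ (u.1 : PowerSeries F) - 1 := by
  simp only [HH, Subgroup.mem_subgroupOf, MonoidHom.mem_ker, Units.ext_iff, Units.coe_map,
    Units.val_one]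
  rw [← Ideal.mem_span_singleton, ← Ideal.Quotient.eq, map_one]
  rfl

noncomputable def un (h : F[X]) (hh : h.Monic) : UU F :=
  ⟨((PowerSeries.isUnit_iff_constantCoeff (φ := (h.reverse : PowerSeries F))).2
    (by simp [hh.leadingCoeff])).unit, by simp [mem_UU, hh.leadingCoeff]⟩

lemma un_val (h : F[X]) (hh : h.Monic) : ((un h hh).1 : PowerSeries F) = (h.reverse : PowerSeries F) := rfl

lemma mk_eq (u u' : UU F) : (QuotientGroup.mk u : UU F ⧸ HH F m) = QuotientGroup.mk u' ↔
    ∀ i ≤ m, PowerSeries.coeff i (u.1 : PowerSeries F) = PowerSeries.coeff i (u'.1 : PowerSeries F) := by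
  rw [QuotientGroup.eq, mem_HH]
  have h1 : (((u⁻¹ * u' : UU F)).1 : PowerSeries F) - 1 =
    ((u.1⁻¹ : (PowerSeries F)ˣ) : PowerSeries F) * ((u'.1 : PowerSeries F) - (u.1 : PowerSeries F)) := by
    rw [mul_sub, Units.inv_mul]; rfl
  rw [h1, (Units.isUnit _).dvd_mul_left, PowerSeries.X_pow_dvd_iff]
  simp only [map_sub, sub_eq_zero, Nat.lt_succ_iff]
  exact forall_congr' fun i => ⟨fun h hi => (h hi).symm, fun h hi => (h hi).symm⟩

open Classical in
noncomputable def phi : Ph F m (Additive (UU F ⧸ HH F m)) where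
  φ h := if hh : h.Monic then Additive.ofMul (QuotientGroup.mk (un h hh)) else 0
  mul h h' hh hh' := by
    rw [dif_pos hh, dif_pos hh', dif_pos (hh.mul hh'), ← ofMul_mul, ← QuotientGroup.mk_mul]
    congr 2
    apply Subtype.ext
    apply Units.ext
    change ((h * h').reverse : PowerSeries F) = (h.reverse : PowerSeries F) * (h'.reverse : PowerSeries F)
    rw [reverse_mul_of_domain, Polynomial.coe_mul]
  eq_iff h h' hh hh' := by
    rw [dif_pos hh, dif_pos hh', Additive.ofMul.injective.eq_iff, mk_eq]
    simp [un_val]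
  surj g := by
    obtain ⟨u, hu⟩ := QuotientGroup.mk_surjective (Additive.toMul g)
    have hu0 := (mem_UU u.1).1 u.2
    set t := PowerSeries.trunc (m+1) (u.1 : PowerSeries F) with ht
    have ht0 : t.coeff 0 = 1 := by
      rw [ht, PowerSeries.coeff_trunc, if_pos (by omega)]; simpa using hu0
    have htd : t.natDegree ≤ m := Nat.lt_succ_iff.1 (PowerSeries.natDegree_trunc_lt _ _)
    have hc : (t.reflect m).coeff m = 1 := by
      rw [coeff_reflect, revAt_le le_rfl, Nat.sub_self, ht0]
    have hd : (t.reflect m).natDegree ≤ m := (natDegree_reflect_le).trans (by simp [htd])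
    have hmon : (t.reflect m).Monic := monic_of_natDegree_le_of_coeff_eq_one m hd hc
    have hd' : (t.reflect m).natDegree = m := le_antisymm hd (le_natDegree_of_ne_zero (by rw [hc]; exact one_ne_zero))
    refine ⟨t.reflect m, hmon, hd', ?_⟩
    rw [dif_pos hmon]
    apply Additive.toMul.injective
    rw [toMul_ofMul, ← hu, mk_eq]
    intro i hi
    rw [un_val, Polynomial.coeff_coe, reverse, hd', reflect_reflect, ht, PowerSeries.coeff_trunc,
      if_pos (by omega)]
end Ex

namespace Ph
variable {F : Type*} [Field F] {m : ℕ} {G : Type*} [AddCommGroup G] (P : Ph F m G)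

lemma one : P.φ 1 = 0 := by
  have := P.mul 1 1 monic_one monic_one
  rw [mul_one] at this
  exact left_eq_add.1 this

lemma pow (h : F[X]) (hh : h.Monic) (n : ℕ) : P.φ (h ^ n) = n • P.φ h := by
  induction n with
  | zero => simp [P.one]
  | succ n ih => rw [pow_succ, P.mul _ _ (hh.pow n) hh, ih, succ_nsmul]

lemma prod {ι : Type*} (s : Finset ι) (h : ι → F[X]) (hh : ∀ i ∈ s, (h i).Monic) :
    P.φ (∏ i ∈ s, h i) = ∑ i ∈ s, P.φ (h i) := by
  classical
  induction s using Finset.induction_on with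
  | empty => simp [P.one]
  | insert a s ha ih =>
    rw [Finset.prod_insert ha, Finset.sum_insert ha, P.mul _ _ (hh _ (by simp))
      (monic_prod_of_monic _ _ fun i hi => hh i (by simp [hi])), ih fun i hi => hh i (by simp [hi])]

lemma eq_iff_same (h h' : F[X]) (hh : h.Monic) (hh' : h'.Monic) (e : h.natDegree = h'.natDegree) (t : ℕ)
    (ht : h.natDegree = t + m) : P.φ h = P.φ h' ↔ (h' - h).degree < t := by
  rw [P.eq_iff h h' hh hh', degree_lt_iff_coeff_zero]
  simp only [coeff_sub, sub_eq_zero]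
  constructor
  · intro H j hj
    by_cases hj2 : j ≤ t + m
    · have := H (t + m - j) (by omega)
      rw [coeff_reverse, coeff_reverse, ← e, ht, revAt_le (by omega)] at this
      rw [show t + m - (t + m - j) = j by omega] at this
      exact this.symm
    · rw [coeff_eq_zero_of_natDegree_lt (by omega), coeff_eq_zero_of_natDegree_lt (by omega)]
  · intro H i hi
    rw [coeff_reverse, coeff_reverse, ← e, ht, revAt_le (by omega)]
    exact (H _ (by omega)).symm

lemma φX : P.φ X = 0 := by
  rw [← P.one, P.eq_iff _ _ monic_X monic_one]
  intro i _
  have : (X : F[X]).reverse = (1 : F[X]).reverse := by simpa using reverse_mul_X (1 : F[X])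
  rw [this]

variable [Fintype F] [DecidableEq G]

lemma fiber (g : G) (t : ℕ) : ((Mon F (t + m)).filter (fun h => P.φ h = g)).card = Fintype.card F ^ t := by
  obtain ⟨h0, h1, h2, rfl⟩ := P.surj g
  rw [← card_Lt]
  have h3 : (X ^ t * h0).Monic := (monic_X_pow t).mul h1
  have h4 : (X ^ t * h0).natDegree = t + m := by
    rw [(monic_X_pow t).natDegree_mul h1, natDegree_X_pow, h2]
  have h5 : P.φ (X ^ t * h0) = P.φ h0 := by
    rw [P.mul _ _ (monic_X_pow t) h1, P.pow _ monic_X, P.φX]; simp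
  rw [← h5]
  symm
  apply Finset.card_nbij' (fun e => X ^ t * h0 + e) (fun h => h - X ^ t * h0)
  · intro e he
    rw [Finset.mem_coe, mem_Lt] at he
    have hlt : e.degree < (X ^ t * h0).degree := by
      rw [degree_eq_natDegree h3.ne_zero, h4]
      exact lt_of_lt_of_le he (by exact_mod_cast Nat.le_add_right _ _)
    rw [Finset.mem_coe, Finset.mem_filter, mem_Mon]
    have h6 : (X ^ t * h0 + e).Monic := h3.add_of_left hlt
    have h7 : (X ^ t * h0 + e).natDegree = t + m := by rw [natDegree_add_eq_left_of_degree_lt hlt, h4]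
    refine ⟨⟨h6, h7⟩, ?_⟩
    rw [eq_comm, P.eq_iff_same _ _ h3 h6 (by rw [h4, h7]) t h4]
    simpa using he
  · intro h hh
    rw [Finset.mem_coe, Finset.mem_filter, mem_Mon] at hh
    rw [Finset.mem_coe, mem_Lt]
    exact (P.eq_iff_same _ _ h3 hh.1.1 (by rw [h4, hh.1.2]) t h4).1 hh.2.symm
  · intro e _; simp
  · intro h _; simp

include P in
lemma card_G [Fintype G] : Fintype.card G = Fintype.card F ^ m := by
  rw [← card_Mon (F := F) m, Finset.card_eq_sum_card_fiberwise (f := P.φ) (t := Finset.univ) (by simp)]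
  have : ∀ g ∈ (Finset.univ : Finset G), ((Mon F m).filter (fun h => P.φ h = g)).card = 1 := by
    intro g _
    have := P.fiber g 0
    simpa using this
  rw [Finset.sum_congr rfl this]
  simp

include P in
lemma finite : Finite G := by
  apply Finite.of_surjective (fun h : Mon F m => P.φ h)
  intro g
  obtain ⟨h, h1, h2, h3⟩ := P.surj g
  exact ⟨⟨h, mem_Mon.2 ⟨h1, h2⟩⟩, h3⟩

end Ph

end Step

set_option linter.unusedSectionVars false
namespace Step

section C
variable {F : Type*} [Field F] [Fintype F]

open Classical in
noncomputable def MI (F : Type*) [Field F] [Fintype F] (d : ℕ) : Finset F[X] :=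
  ((Finset.Icc 1 d).biUnion (Mon F)).filter Irreducible

lemma mem_MI {d : ℕ} {h : F[X]} : h ∈ MI F d ↔ h.Monic ∧ Irreducible h ∧ h.natDegree ≤ d := by
  simp only [MI, Finset.mem_filter, Finset.mem_biUnion, Finset.mem_Icc, mem_Mon]
  constructor
  · rintro ⟨⟨e, h1, h2, h3⟩, h4⟩
    exact ⟨h2, h4, by omega⟩
  · rintro ⟨h1, h2, h3⟩
    exact ⟨⟨_, ⟨h2.natDegree_pos, h3⟩, h1, rfl⟩, h2⟩

noncomputable def cc (Λ : F[X] → ℂ) (d : ℕ) : ℂ := ∑ h ∈ Mon F d, Λ h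
noncomputable def SS (Λ : F[X] → ℂ) (n : ℕ) : ℂ :=
  ∑ P ∈ (MI F n).filter (fun P => P.natDegree ∣ n), (P.natDegree : ℂ) * Λ P ^ (n / P.natDegree)

lemma sum_MI (h : F[X]) (hh : h.Monic) :
    ∑ P ∈ MI F h.natDegree, P.natDegree * multiplicity P h = h.natDegree := by
  classical
  have h1 : (UniqueFactorizationMonoid.normalizedFactors h).prod = h := by
    have := UniqueFactorizationMonoid.prod_normalizedFactors_eq hh.ne_zero
    rw [this, hh.normalize_eq_self]
  have hmem : ∀ P ∈ UniqueFactorizationMonoid.normalizedFactors h, P.Monic ∧ Irreducible P ∧ P.natDegree ≤ h.natDegree := by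
    intro P hP
    have hi := UniqueFactorizationMonoid.irreducible_of_normalized_factor P hP
    refine ⟨?_, hi, natDegree_le_of_dvd (UniqueFactorizationMonoid.dvd_of_mem_normalizedFactors hP) hh.ne_zero⟩
    have := UniqueFactorizationMonoid.normalize_normalized_factor P hP
    rw [← this]
    exact monic_normalize hi.ne_zero
  conv_rhs => rw [← h1]
  rw [natDegree_multiset_prod_of_monic _ (fun P hP => (hmem P hP).1), Finset.sum_multiset_map_count]
  symm
  apply Finset.sum_subset_zero_on_sdiff
  · intro P hP
    rw [Multiset.mem_toFinset] at hP
    exact mem_MI.2 (hmem P hP)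
  · intro P hP
    rw [Finset.mem_sdiff, mem_MI, Multiset.mem_toFinset] at hP
    rw [mul_eq_zero]
    right
    apply multiplicity_eq_zero.2
    intro hd
    obtain ⟨P', hP', ha⟩ := UniqueFactorizationMonoid.exists_mem_normalizedFactors_of_dvd hh.ne_zero hP.1.2.1 hd
    have := eq_of_monic_of_associated hP.1.1 (hmem P' hP').1 ha
    rw [← this] at hP'
    exact hP.2 hP'
  · intro P hP
    rw [Multiset.mem_toFinset] at hP
    have hi := (hmem P hP).2.1
    have h2 := UniqueFactorizationMonoid.emultiplicity_eq_count_normalizedFactors hi hh.ne_zero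
    rw [(hmem P hP).1.normalize_eq_self] at h2
    rw [smul_eq_mul, mul_comm, multiplicity_eq_of_emultiplicity_eq_some h2]

open Classical in
lemma count_n (h P : F[X]) (hh : h.Monic) (hP : P.Monic) (hi : Irreducible P) :
    ((Finset.Icc 1 h.natDegree).filter (fun n => P.natDegree ∣ n ∧ P ^ (n / P.natDegree) ∣ h)).card
      = multiplicity P h := by
  classical
  have hpos := hi.natDegree_pos
  have hfin : FiniteMultiplicity P h := by
    apply FiniteMultiplicity.of_prime_left hi.prime hh.ne_zero
  rw [← Nat.card_Icc 1 (multiplicity P h) |>.trans (Nat.add_sub_cancel _ _)]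
  apply Finset.card_nbij' (fun n => n / P.natDegree) (fun t => t * P.natDegree)
  · intro n hn
    simp only [Finset.coe_filter, Finset.mem_Icc, Set.mem_setOf_eq, Finset.coe_Icc, Set.mem_Icc] at hn ⊢
    exact ⟨Nat.div_pos (Nat.le_of_dvd (by omega) hn.2.1) hpos, hfin.le_multiplicity_of_pow_dvd hn.2.2⟩
  · intro t ht
    simp only [Finset.coe_filter, Finset.mem_Icc, Set.mem_setOf_eq, Finset.coe_Icc, Set.mem_Icc] at ht ⊢
    have hd : P ^ t ∣ h := pow_dvd_of_le_multiplicity ht.2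
    refine ⟨⟨Nat.mul_pos ht.1 hpos, ?_⟩, Dvd.intro_left _ rfl, ?_⟩
    · rw [← hP.natDegree_pow]
      exact natDegree_le_of_dvd hd hh.ne_zero
    · rwa [Nat.mul_div_cancel _ hpos]
  · intro n hn
    simp only [Finset.coe_filter, Finset.mem_Icc, Set.mem_setOf_eq] at hn
    exact Nat.div_mul_cancel hn.2.1
  · intro t _
    exact Nat.mul_div_cancel _ hpos

lemma sum_dvd (Λ : F[X] → ℂ) (hΛ : ∀ h h', h.Monic → h'.Monic → Λ (h * h') = Λ h * Λ h') (P : F[X])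
    (hP : P.Monic) (d : ℕ) (hd : P.natDegree ≤ d) [DecidablePred (fun h => P ∣ h)] :
    ∑ h ∈ (Mon F d).filter (fun h => P ∣ h), Λ h = Λ P * cc Λ (d - P.natDegree) := by
  rw [cc, Finset.mul_sum]
  symm
  apply Finset.sum_bij (fun h _ => P * h)
  · intro h hh
    rw [mem_Mon] at hh
    rw [Finset.mem_filter, mem_Mon]
    refine ⟨⟨hP.mul hh.1, ?_⟩, Dvd.intro _ rfl⟩
    rw [hP.natDegree_mul hh.1, hh.2]; omega
  · intro h _ h' _ e
    exact mul_left_cancel₀ hP.ne_zero e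
  · intro h hh
    rw [Finset.mem_filter, mem_Mon] at hh
    obtain ⟨⟨h1, h2⟩, h', rfl⟩ := hh
    have h3 := hP.of_mul_monic_left h1
    refine ⟨h', mem_Mon.2 ⟨h3, ?_⟩, rfl⟩
    rw [hP.natDegree_mul h3] at h2; omega
  · intro h hh
    rw [hΛ _ _ hP (mem_Mon.1 hh).1]

lemma Λpow (Λ : F[X] → ℂ) (h1 : Λ 1 = 1) (hΛ : ∀ h h', h.Monic → h'.Monic → Λ (h * h') = Λ h * Λ h') (P : F[X])
    (hP : P.Monic) (n : ℕ) : Λ (P ^ n) = Λ P ^ n := by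
  induction n with
  | zero => simp [h1]
  | succ n ih => rw [pow_succ, hΛ _ _ (hP.pow n) hP, ih, pow_succ]

theorem recursion (Λ : F[X] → ℂ) (h1 : Λ 1 = 1)
    (hΛ : ∀ h h', h.Monic → h'.Monic → Λ (h * h') = Λ h * Λ h') (d : ℕ) :
    (d : ℂ) * cc Λ d = ∑ n ∈ Finset.Icc 1 d, SS Λ n * cc Λ (d - n) := by
  classical
  have e1 : ∀ n ∈ Finset.Icc 1 d, SS Λ n * cc Λ (d - n) =
      ∑ h ∈ Mon F d, ∑ P ∈ MI F d, if P.natDegree ∣ n ∧ P ^ (n / P.natDegree) ∣ h then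
        (P.natDegree : ℂ) * Λ h else 0 := by
    intro n hn
    rw [Finset.mem_Icc] at hn
    rw [SS, Finset.sum_mul, Finset.sum_comm]
    have e2 : (MI F n).filter (fun P => P.natDegree ∣ n) = (MI F d).filter (fun P => P.natDegree ∣ n) := by
      ext P
      simp only [Finset.mem_filter, mem_MI]
      constructor
      · rintro ⟨⟨h1, h2, h3⟩, h4⟩
        exact ⟨⟨h1, h2, by omega⟩, h4⟩
      · rintro ⟨⟨h1, h2, h3⟩, h4⟩
        exact ⟨⟨h1, h2, Nat.le_of_dvd (by omega) h4⟩, h4⟩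
    rw [e2, Finset.sum_filter]
    apply Finset.sum_congr rfl
    intro P hP
    rw [mem_MI] at hP
    split_ifs with hdv
    · have hdeg : (P ^ (n / P.natDegree)).natDegree = n := by
        rw [hP.1.natDegree_pow, Nat.div_mul_cancel hdv]
      have := sum_dvd Λ hΛ (P ^ (n / P.natDegree)) (hP.1.pow _) d (by omega)
      rw [hdeg, Λpow Λ h1 hΛ P hP.1] at this
      rw [mul_assoc, ← this, Finset.mul_sum, Finset.sum_filter]
      simp [hdv]
    · simp [hdv]
  rw [Finset.sum_congr rfl e1, Finset.sum_comm, cc, Finset.mul_sum]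
  apply Finset.sum_congr rfl
  intro h hh
  rw [mem_Mon] at hh
  rw [Finset.sum_comm]
  have e3 : ∀ P ∈ MI F d, (∑ n ∈ Finset.Icc 1 d, if P.natDegree ∣ n ∧ P ^ (n / P.natDegree) ∣ h then
        (P.natDegree : ℂ) * Λ h else 0) = ((P.natDegree * multiplicity P h : ℕ) : ℂ) * Λ h := by
    intro P hP
    rw [mem_MI] at hP
    rw [← Finset.sum_filter, Finset.sum_const, ← hh.2, count_n h P hh.1 hP.1 hP.2.1]
    push_cast
    rw [nsmul_eq_mul]; ring
  rw [Finset.sum_congr rfl e3, ← Finset.sum_mul, ← Nat.cast_sum, ← hh.2, sum_MI h hh.1]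

end C
end Step

set_option linter.unusedSectionVars false
namespace Step

section D
variable {F : Type*} [Field F] [Fintype F]
variable {k : Type*} [Field k] [Algebra F k] [IsAlgClosed k] [Algebra.IsAlgebraic F k]

noncomputable def nu (F : Type*) [Field F] {k : Type*} [Field k] [Algebra F k] (n : ℕ) (a : k) : F[X] :=
  minpoly F a ^ (n / (minpoly F a).natDegree)

lemma mp_dvd (n : ℕ) (a : k) : a ^ (Fintype.card F) ^ n = a ↔ (minpoly F a).natDegree ∣ n := by
  have hi := minpoly.irreducible (Algebra.IsIntegral.isIntegral (R := F) a)
  rw [hi.natDegree_dvd_iff_dvd_X_pow_card_pow_sub_X, Nat.card_eq_fintype_card, minpoly.dvd_iff]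
  simp [sub_eq_zero]

lemma nu_monic (n : ℕ) (a : k) : (nu F n a).Monic :=
  (minpoly.monic (Algebra.IsIntegral.isIntegral (R := F) a)).pow _

lemma frob_inj (i : ℕ) (a b : k) (h : a ^ (Fintype.card F) ^ i = b ^ (Fintype.card F) ^ i) : a = b := by
  induction i with
  | zero => simpa using h
  | succ i ih =>
    apply ih
    rw [pow_succ, pow_mul, pow_mul] at h
    exact (FiniteField.frobeniusAlgHom F k).injective h

lemma mp_prod (a : k) : (minpoly F a).map (algebraMap F k) =
    ∏ i ∈ Finset.range (minpoly F a).natDegree, (X - C (a ^ (Fintype.card F) ^ i)) := by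
  have hint := Algebra.IsIntegral.isIntegral (R := F) a
  have hm := minpoly.monic hint
  symm
  refine (eq_of_monic_of_dvd_of_natDegree_le (p := ∏ i ∈ Finset.range (minpoly F a).natDegree, (X - C (a ^ (Fintype.card F) ^ i))) (q := (minpoly F a).map (algebraMap F k)) ?_ ?_ ?_ ?_).symm
  · exact monic_prod_of_monic _ _ fun i _ => monic_X_sub_C _
  · exact hm.map _
  · apply Finset.prod_dvd_of_coprime
    · intro i hi j hj hij
      rw [Finset.mem_coe, Finset.mem_range] at hi hj
      apply isCoprime_X_sub_C_of_isUnit_sub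
      rw [isUnit_iff_ne_zero, sub_ne_zero]
      intro he
      wlog hlt : i < j generalizing i j
      · exact this hj hi hij.symm he.symm (by omega)
      obtain ⟨t, rfl⟩ := Nat.exists_eq_add_of_lt hlt
      have h1 : a ^ (Fintype.card F) ^ (t + 1) = a := by
        symm
        apply frob_inj (F := F) i
        rw [he, ← pow_mul, ← pow_add]
        congr 2; omega
      have h2 := Nat.le_of_dvd (by omega) ((mp_dvd _ _).1 h1)
      omega
    · intro i _
      rw [dvd_iff_isRoot, IsRoot, eval_map_algebraMap]
      have : ∀ i, aeval (a ^ (Fintype.card F) ^ i) (minpoly F a) = 0 := by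
        intro i
        induction i with
        | zero => simp
        | succ i ih =>
          rw [pow_succ, pow_mul]
          have := congrArg (FiniteField.frobeniusAlgHom F k) ih
          rw [map_zero, ← aeval_algHom_apply] at this
          exact this
      exact this i
  · rw [natDegree_map, natDegree_prod_of_monic _ _ (fun i _ => monic_X_sub_C _)]
    simp only [natDegree_X_sub_C, Finset.sum_const, Finset.card_range, smul_eq_mul, mul_one, le_refl]

lemma nu_prod (n : ℕ) (a : k) (ha : a ^ (Fintype.card F) ^ n = a) : (nu F n a).map (algebraMap F k) =
    ∏ i ∈ Finset.range n, (X - C (a ^ (Fintype.card F) ^ i)) := by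
  have h1 := (mp_dvd _ _).1 ha
  have hpos := minpoly.natDegree_pos (Algebra.IsIntegral.isIntegral (R := F) a)
  have he := (mp_dvd (F := F) _ a).2 dvd_rfl
  have hp := mp_prod (F := F) a
  unfold nu
  rw [Polynomial.map_pow, hp]
  obtain ⟨s, hs⟩ := h1
  rw [hs, Nat.mul_div_cancel_left _ hpos]
  generalize (minpoly F a).natDegree = e at *
  clear hs
  induction s with
  | zero => simp
  | succ s ih =>
    have hes : ∀ s, a ^ (Fintype.card F) ^ (e * s) = a := by
      intro s
      induction s with
      | zero => simp
      | succ s ih => rw [mul_add, pow_add, pow_mul, ih, mul_one, he]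
    rw [pow_succ, ih, mul_add, mul_one, Finset.prod_range_add]
    congr 1
    apply Finset.prod_congr rfl
    intro i _
    rw [pow_add, pow_mul, hes]

lemma ps_frob (a : k) (u : ℕ → k) (h0 : u 0 = 1) (hu : ∀ l, u (l + 1) ^ (Fintype.card F) = u (l + 1) - a * u l) (n : ℕ) :
    PowerSeries.mk (fun l => u l ^ (Fintype.card F) ^ n) = PowerSeries.mk u *
      ∏ i ∈ Finset.range n, (1 - PowerSeries.C (a ^ (Fintype.card F) ^ i) * PowerSeries.X) := by
  induction n with
  | zero => simp
  | succ n ih =>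
    let σ : k →+* k := (FiniteField.frobeniusAlgHom F k).toRingHom
    have hσ : ∀ x, σ x = x ^ (Fintype.card F) := fun x => rfl
    have h1 : PowerSeries.mk (fun l => u l ^ (Fintype.card F) ^ (n + 1)) = PowerSeries.map σ (PowerSeries.mk (fun l => u l ^ (Fintype.card F) ^ n)) := by
      ext l; simp [hσ, pow_succ, pow_mul]
    have h2 : PowerSeries.map σ (PowerSeries.mk u) = PowerSeries.mk u * (1 - PowerSeries.C a * PowerSeries.X) := by
      ext l
      rw [PowerSeries.coeff_map, PowerSeries.coeff_mk, hσ, mul_sub, mul_one, mul_left_comm]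
      rcases l with _ | l
      · simp [h0]
      · rw [hu]
        simp [← mul_assoc, PowerSeries.coeff_succ_mul_X]
    rw [h1, ih, map_mul, h2, map_prod, Finset.prod_range_succ', mul_assoc]
    congr 1
    rw [mul_comm, pow_zero, pow_one]
    congr 1
    apply Finset.prod_congr rfl
    intro i _
    rw [map_sub, map_one, map_mul, PowerSeries.map_X, PowerSeries.map_C, hσ, ← pow_mul, ← pow_succ]

lemma rev_XC (b : k) : (X - C b).reverse = 1 - C b * X := by
  rw [sub_eq_add_neg, ← C_neg, reverse_add_C]
  have : (X : k[X]).reverse = 1 := by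
    have := reverse_mul_X (1 : k[X])
    rw [one_mul] at this
    rw [this]
    simpa using reverse_C (1 : k)
  rw [this]; simp [sub_eq_add_neg]

lemma rev_prod {ι : Type*} (s : Finset ι) (f : ι → k[X]) : (∏ i ∈ s, f i).reverse = ∏ i ∈ s, (f i).reverse := by
  classical
  induction s using Finset.induction_on with
  | empty => simpa using reverse_C (1 : k)
  | insert a s ha ih => rw [Finset.prod_insert ha, Finset.prod_insert ha, reverse_mul_of_domain, ih]

lemma pt_rel (a : k) (u : ℕ → k) (h0 : u 0 = 1) (hu : ∀ l, u (l + 1) ^ (Fintype.card F) = u (l + 1) - a * u l) (n : ℕ)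
    (ha : a ^ (Fintype.card F) ^ n = a) (l : ℕ) : u l ^ (Fintype.card F) ^ n =
      ∑ j ∈ Finset.range (l + 1), algebraMap F k ((nu F n a).reverse.coeff j) * u (l - j) := by
  have h1 := congrArg (PowerSeries.coeff l) (ps_frob a u h0 hu n)
  have h2 : (∏ i ∈ Finset.range n, (1 - PowerSeries.C (a ^ (Fintype.card F) ^ i) * PowerSeries.X) : PowerSeries k) =
      ((((nu F n a).reverse).map (algebraMap F k) : k[X]) : PowerSeries k) := by
    have h3 : ((nu F n a).reverse).map (algebraMap F k) = ((nu F n a).map (algebraMap F k)).reverse := by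
      unfold reverse; rw [natDegree_map, reflect_map]
    rw [h3, nu_prod n a ha, rev_prod]
    simp only [rev_XC]
    rw [← Polynomial.coeToPowerSeries.ringHom_apply, map_prod]
    simp
  rw [PowerSeries.coeff_mk, h2, mul_comm, PowerSeries.coeff_mul, Finset.Nat.sum_antidiagonal_eq_sum_range_succ_mk] at h1
  rw [h1]
  apply Finset.sum_congr rfl
  intro j _
  simp

omit [Algebra.IsAlgebraic F k] in
lemma exists_root (b : k) : ∃ x : k, x ^ (Fintype.card F) = x - b := by
  have hq : 1 < (Fintype.card F) := Fintype.one_lt_card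
  have hd : (X ^ (Fintype.card F) + (C b - X) : k[X]).degree = (Fintype.card F) := by
    rw [degree_add_eq_left_of_degree_lt, degree_X_pow]
    rw [degree_X_pow]
    apply lt_of_le_of_lt (degree_sub_le _ _)
    rw [degree_X, max_lt_iff]
    exact ⟨lt_of_le_of_lt degree_C_le (by exact_mod_cast (by omega)), by exact_mod_cast hq⟩
  obtain ⟨x, hx⟩ := IsAlgClosed.exists_root (X ^ (Fintype.card F) + (C b - X) : k[X]) (by
    rw [hd]; exact_mod_cast (by omega))
  refine ⟨x, ?_⟩
  simp [IsRoot] at hx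
  linear_combination hx

noncomputable def rho (F : Type*) [Field F] [Fintype F] {k : Type*} [Field k] [Algebra F k] [IsAlgClosed k] (b : k) : k :=
  (exists_root (F := F) b).choose

lemma rho_spec (b : k) : rho F b ^ (Fintype.card F) = rho F b - b := (exists_root (F := F) b).choose_spec

noncomputable def pt (a : k) (v : ℕ → F) : ℕ → k
  | 0 => 1
  | l + 1 => rho F (a * pt a v l) + algebraMap F k (v l)

lemma pt_step (a : k) (v : ℕ → F) (l : ℕ) : pt a v (l + 1) ^ (Fintype.card F) = pt a v (l + 1) - a * pt a v l := by
  have h : ∀ x y : k, (x + y) ^ (Fintype.card F) = x ^ (Fintype.card F) + y ^ (Fintype.card F) := fun x y => map_add (FiniteField.frobeniusAlgHom F k) x y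
  rw [pt, h, rho_spec, ← map_pow, FiniteField.pow_card]
  ring

open Classical in
noncomputable def Fix (F : Type*) [Field F] [Fintype F] (k : Type*) [Field k] [Algebra F k] (n : ℕ) : Finset k :=
  (X ^ (Fintype.card F) ^ n - X : k[X]).roots.toFinset

open Classical in
lemma mem_Fix {n : ℕ} (hn : 1 ≤ n) {a : k} : a ∈ Fix F k n ↔ a ^ (Fintype.card F) ^ n = a := by
  have hq : 1 < (Fintype.card F) := Fintype.one_lt_card
  rw [Fix, Multiset.mem_toFinset, mem_roots (FiniteField.X_pow_card_sub_X_ne_zero k (Nat.one_lt_pow (by omega) hq))]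
  simp [sub_eq_zero]

lemma card_Fix {n : ℕ} (hn : 1 ≤ n) : (Fix F k n).card = (Fintype.card F) ^ n := by
  classical
  have hq : 1 < (Fintype.card F) := Fintype.one_lt_card
  have h1 : 1 < (Fintype.card F) ^ n := Nat.one_lt_pow (by omega) hq
  obtain ⟨p, hp⟩ := CharP.exists F
  have hpk : CharP k p := charP_of_injective_algebraMap (algebraMap F k).injective p
  obtain ⟨f, hpp, hf⟩ := FiniteField.card F p
  have hsep : (X ^ (Fintype.card F) ^ n - X : k[X]).Separable := galois_poly_separable p _ (by
    rw [hf, ← pow_mul]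
    exact dvd_pow_self p (Nat.mul_pos f.pos hn).ne')
  rw [Fix, Multiset.toFinset_card_of_nodup (nodup_roots hsep), IsAlgClosed.card_roots_eq_natDegree,
    FiniteField.X_pow_card_sub_X_natDegree_eq k h1]

open Classical in
theorem points {m : ℕ} (hm : 1 ≤ m) {G : Type*} [AddCommGroup G] (P : Ph F m G) :
    ∃ C h0 : ℕ, ∀ h, h0 ≤ h → ∀ g : G,
      (Fintype.card F) ^ m * ((Fix F k (2 * h)).filter (fun a => P.φ (nu F (2 * h) a) = g)).card ≤ (Fintype.card F) ^ (2 * h) + C * (Fintype.card F) ^ h := by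
  have hq : 1 < (Fintype.card F) := Fintype.one_lt_card
  obtain ⟨p, hp⟩ := CharP.exists F
  have hpk : CharP k p := charP_of_injective_algebraMap (algebraMap F k).injective p
  obtain ⟨f, hpp, hf⟩ := FiniteField.card F p
  have := Fact.mk hpp
  have : ExpChar k p := ExpChar.prime hpp
  obtain ⟨C, h0, H⟩ := stepanov k p f (Fintype.card F) m hf hq hm
  refine ⟨C, h0 + 1, fun h hh g => ?_⟩
  obtain ⟨hg, hg1, _, hg3⟩ := P.surj g
  let A := (Fix F k (2 * h)).filter (fun a => P.φ (nu F (2 * h) a) = g)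
  let ext : (Fin m → F) → ℕ → F := fun v l => if hl : l < m then v ⟨l, hl⟩ else 0
  have := H h (by omega) (A × (Fin m → F)) (fun i => pt i.1.1 (ext i.2))
    (fun j => algebraMap F k (hg.reverse.coeff j)) ?_ ?_
  · rw [Fintype.card_prod, Fintype.card_pi_const, Fintype.card_coe, mul_comm] at this
    exact this
  · refine ⟨fun i => rfl, ?_, ?_⟩
    · intro i l
      have h2 := pt_step i.1.1 (ext i.2) 0
      have h3 : pt i.1.1 (ext i.2) 0 = 1 := rfl
      rw [h3] at h2
      simp only [zero_add] at h2
      rw [pt_step, h2]; ring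
    · rintro ⟨a, v⟩ ⟨b, w⟩ hne
      by_contra hcon
      push Not at hcon
      simp only at hcon
      apply hne
      have hall : ∀ l ≤ m, pt a.1 (ext v) l = pt b.1 (ext w) l := by
        intro l hl
        rcases l with _ | l
        · rfl
        · exact hcon l hl
      have hab : a.1 = b.1 := by
        have h2 := pt_step a.1 (ext v) 0
        have h3 := pt_step b.1 (ext w) 0
        rw [show pt a.1 (ext v) 0 = 1 from rfl, hall _ (by omega)] at h2
        rw [show pt b.1 (ext w) 0 = 1 from rfl, h2] at h3
        linear_combination -h3
      refine Prod.ext (Subtype.ext hab) ?_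
      funext l
      have h4 := hcon l l.2
      rw [pt, pt, hall l l.2.le, hab] at h4
      have h5 := (algebraMap F k).injective (add_left_cancel h4)
      simpa [ext] using h5
  · rintro ⟨⟨a, ha⟩, v⟩ l hl
    rw [Finset.mem_filter, mem_Fix (by omega)] at ha
    simp only
    rw [pt_rel a _ rfl (pt_step a (ext v)) (2 * h) ha.1]
    apply Finset.sum_congr rfl
    intro j hj
    rw [Finset.mem_range] at hj
    rw [(P.eq_iff _ _ (nu_monic _ _) hg1).1 (ha.2.trans hg3.symm) j (by omega)]

end D
end Step

set_option linter.unusedSectionVars false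
namespace Step

section D
variable {F : Type*} [Field F] [Fintype F]

open Classical in
lemma card_mp {k : Type*} [Field k] [Algebra F k] [IsAlgClosed k] [Algebra.IsAlgebraic F k]
    (n : ℕ) (hn : 1 ≤ n) (P : F[X]) (hP : P.Monic) (hi : Irreducible P) (hd : P.natDegree ∣ n) :
    ((Fix F k n).filter (fun a => minpoly F a = P)).card = P.natDegree := by
  have hs : (P.map (algebraMap F k)).Separable := (PerfectField.separable_of_irreducible hi).map
  rw [← natDegree_map (algebraMap F k) (p := P), ← IsAlgClosed.card_roots_eq_natDegree,
    ← Multiset.toFinset_card_of_nodup (nodup_roots hs)]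
  congr 1
  ext a
  rw [Finset.mem_filter, mem_Fix hn, Multiset.mem_toFinset, mem_roots (hP.map _).ne_zero, IsRoot,
    eval_map_algebraMap]
  constructor
  · rintro ⟨_, rfl⟩
    exact minpoly.aeval _ _
  · intro h
    have h1 := (minpoly.eq_of_irreducible_of_monic hi h hP).symm
    exact ⟨by rw [mp_dvd (F := F), h1]; exact hd, h1⟩

lemma SS_eq (k : Type*) [Field k] [Algebra F k] [IsAlgClosed k] [Algebra.IsAlgebraic F k]
    (Λ : F[X] → ℂ) (h1 : Λ 1 = 1)
    (hΛ : ∀ h h', h.Monic → h'.Monic → Λ (h * h') = Λ h * Λ h') (n : ℕ) (hn : 1 ≤ n) :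
    SS Λ n = ∑ a ∈ Fix F k n, Λ (nu F n a) := by
  classical
  rw [SS, ← Finset.sum_fiberwise_of_maps_to (s := Fix F k n) (g := minpoly F)
    (t := (MI F n).filter (fun P => P.natDegree ∣ n))]
  · apply Finset.sum_congr rfl
    intro P hP
    rw [Finset.mem_filter, mem_MI] at hP
    rw [← card_mp (k := k) n hn P hP.1.1 hP.1.2.1 hP.2, ← nsmul_eq_mul, ← Finset.sum_const]
    apply Finset.sum_congr rfl
    intro a ha
    rw [Finset.mem_filter] at ha
    rw [card_mp (k := k) n hn P hP.1.1 hP.1.2.1 hP.2, nu, ha.2, Λpow Λ h1 hΛ P hP.1.1]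
  · intro a ha
    rw [mem_Fix hn, mp_dvd] at ha
    have hint := Algebra.IsIntegral.isIntegral (R := F) a
    rw [Finset.mem_filter, mem_MI]
    exact ⟨⟨minpoly.monic hint, minpoly.irreducible hint, Nat.le_of_dvd hn ha⟩, ha⟩

variable {m : ℕ} {G : Type*} [AddCommGroup G]

def Lam (P : Ph F m G) (ψ : AddChar G ℂ) (h : F[X]) : ℂ := ψ (P.φ h)

lemma Lam_one (P : Ph F m G) (ψ : AddChar G ℂ) : Lam P ψ 1 = 1 := by simp [Lam, P.one]

lemma Lam_mul (P : Ph F m G) (ψ : AddChar G ℂ) (h h' : F[X]) (hh : h.Monic) (hh' : h'.Monic) :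
    Lam P ψ (h * h') = Lam P ψ h * Lam P ψ h' := by
  simp [Lam, P.mul h h' hh hh', AddChar.map_add_eq_mul]

theorem SS_bound (hm : 1 ≤ m) (P : Ph F m G) : ∃ C h0 : ℕ, ∀ h, h0 ≤ h → ∀ ψ : AddChar G ℂ, ψ ≠ 0 →
    ‖SS (Lam P ψ) (2 * h)‖ ≤ C * (Fintype.card F : ℝ) ^ h := by
  classical
  have := P.finite
  have := Fintype.ofFinite G
  obtain ⟨C, h0, H⟩ := points (k := AlgebraicClosure F) hm P
  refine ⟨C, h0 + 1, fun h hh ψ hψ => ?_⟩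
  rw [SS_eq (AlgebraicClosure F) _ (Lam_one P ψ) (Lam_mul P ψ) _ (by omega)]
  set T := Fix F (AlgebraicClosure F) (2 * h) with hT
  have hq0 : (0 : ℝ) < Fintype.card F := by exact_mod_cast Fintype.card_pos
  let A : G → ℕ := fun g => (T.filter (fun a => P.φ (nu F (2 * h) a) = g)).card
  have e1 : ∑ a ∈ T, Lam P ψ (nu F (2 * h) a) = ∑ g : G, (A g : ℂ) * ψ g := by
    rw [← Finset.sum_fiberwise_of_maps_to (s := T) (g := fun a => P.φ (nu F (2 * h) a)) (t := Finset.univ) (by simp)]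
    apply Finset.sum_congr rfl
    intro g _
    rw [← nsmul_eq_mul, ← Finset.sum_const]
    apply Finset.sum_congr rfl
    intro a ha
    rw [Finset.mem_filter] at ha
    rw [Lam, ha.2]
  have e2 : ∑ g : G, (A g : ℝ) = (Fintype.card F : ℝ) ^ (2 * h) := by
    have : ∑ g : G, A g = Fintype.card F ^ (2 * h) := by
      rw [← card_Fix (k := AlgebraicClosure F) (by omega : 1 ≤ 2 * h),
        Finset.card_eq_sum_card_fiberwise (f := fun a => P.φ (nu F (2 * h) a)) (t := Finset.univ) (by simp)]
    exact_mod_cast this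
  set B : ℝ := ((Fintype.card F : ℝ) ^ (2 * h) + C * (Fintype.card F : ℝ) ^ h) / (Fintype.card F : ℝ) ^ m with hB
  have hAB : ∀ g, (A g : ℝ) ≤ B := by
    intro g
    rw [hB, le_div_iff₀ (by positivity), mul_comm]
    exact_mod_cast H h (by omega) g
  have e3 : ∑ g : G, (A g : ℂ) * ψ g = ∑ g : G, (((A g : ℝ) - B : ℝ) : ℂ) * ψ g := by
    have : ∑ g : G, ψ g = 0 := AddChar.sum_eq_zero_of_ne_one hψ
    push_cast
    simp only [sub_mul, Finset.sum_sub_distrib, ← Finset.mul_sum, this]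
    simp
  rw [e1, e3]
  calc _ ≤ ∑ g : G, ‖(((A g : ℝ) - B : ℝ) : ℂ) * ψ g‖ := norm_sum_le _ _
    _ = ∑ g : G, (B - A g) := by
      apply Finset.sum_congr rfl
      intro g _
      rw [norm_mul, AddChar.norm_apply, mul_one, Complex.norm_real, Real.norm_eq_abs, abs_of_nonpos (by linarith [hAB g])]
      ring
    _ = C * (Fintype.card F : ℝ) ^ h := by
      rw [Finset.sum_sub_distrib, e2, Finset.sum_const, Finset.card_univ, P.card_G, nsmul_eq_mul, hB]
      push_cast
      field_simp
      ring
    _ ≤ _ := le_rfl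

open Classical in
lemma cc_eq (P : Ph F m G) [Fintype G] (ψ : AddChar G ℂ) (t : ℕ) : cc (Lam P ψ) (t + m) = if ψ = 0 then (Fintype.card F : ℂ) ^ (t + m) else 0 := by
  rw [cc, ← Finset.sum_fiberwise_of_maps_to (s := Mon F (t + m)) (g := P.φ) (t := Finset.univ) (by simp)]
  have : ∀ g ∈ (Finset.univ : Finset G), ∑ h ∈ (Mon F (t + m)).filter (fun h => P.φ h = g), Lam P ψ h = (Fintype.card F : ℂ) ^ t * ψ g := by
    intro g _
    rw [Finset.sum_congr rfl (g := fun _ => ψ g) (fun h hh => by rw [Lam, (Finset.mem_filter.1 hh).2]),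
      Finset.sum_const, P.fiber, nsmul_eq_mul]
    push_cast; rfl
  rw [Finset.sum_congr rfl this, ← Finset.mul_sum, AddChar.sum_eq_ite, P.card_G]
  split_ifs
  · push_cast; rw [pow_add]
  · simp
end D
end Step

set_option linter.unusedSectionVars false
namespace Step

lemma pow_bdd (w : ℂ) (M : ℝ) (h0 : ℕ) (H : ∀ h, h0 ≤ h → ‖w‖ ^ h ≤ M) : ‖w‖ ≤ 1 := by
  by_contra hc
  push Not at hc
  obtain ⟨n, hn⟩ := pow_unbounded_of_one_lt M hc
  have h1 := H (max h0 n) (le_max_left _ _)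
  have h2 := pow_le_pow_right₀ hc.le (le_max_right h0 n)
  linarith

lemma psum_bdd {ι : Type*} [Fintype ι] (z : ι → ℂ) (C' : ℝ) (h0 : ℕ)
    (H : ∀ h, h0 ≤ h → ‖∑ i, z i ^ h‖ ≤ C') (i0 : ι) : ‖z i0‖ ≤ 1 := by
  classical
  set w := z i0 with hw
  let D := (Finset.univ.image z).erase w
  let Q : ℂ[X] := ∏ d ∈ D, (X - C d)
  have hQ0 : Q.eval w ≠ 0 := by
    rw [eval_prod, Finset.prod_ne_zero_iff]
    intro d hd
    simp only [eval_sub, eval_X, eval_C]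
    exact sub_ne_zero.2 (Finset.ne_of_mem_erase hd).symm
  have hQ1 : ∀ i, z i ≠ w → Q.eval (z i) = 0 := by
    intro i hi
    rw [eval_prod, Finset.prod_eq_zero_iff]
    exact ⟨z i, Finset.mem_erase.2 ⟨hi, Finset.mem_image_of_mem _ (Finset.mem_univ _)⟩, by simp⟩
  set N := (Finset.univ.filter (fun i => z i = w)).card with hN
  have hN1 : 1 ≤ N := Finset.card_pos.2 ⟨i0, by simp [hw]⟩
  have key : ∀ h, (N : ℂ) * (Q.eval w * w ^ h) = ∑ j ∈ Finset.range (Q.natDegree + 1), Q.coeff j * ∑ i, z i ^ (j + h) := by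
    intro h
    have e1 : ∑ i, Q.eval (z i) * z i ^ h = (N : ℂ) * (Q.eval w * w ^ h) := by
      rw [← nsmul_eq_mul, ← Finset.sum_const, Finset.sum_filter]
      apply Finset.sum_congr rfl
      intro i _
      split_ifs with hi
      · rw [hi]
      · rw [hQ1 i hi, zero_mul]
    rw [← e1]
    simp only [Finset.mul_sum]
    rw [Finset.sum_comm]
    apply Finset.sum_congr rfl
    intro i _
    rw [eval_eq_sum_range, Finset.sum_mul]
    apply Finset.sum_congr rfl
    intro j _
    rw [pow_add]; ring
  have hQp : 0 < ‖Q.eval w‖ := norm_pos_iff.2 hQ0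
  apply pow_bdd w ((∑ j ∈ Finset.range (Q.natDegree + 1), ‖Q.coeff j‖ * C') / ‖Q.eval w‖) h0
  intro h hh
  rw [le_div_iff₀ hQp, ← norm_pow, ← norm_mul]
  calc ‖w ^ h * Q.eval w‖ = 1 * ‖Q.eval w * w ^ h‖ := by rw [one_mul, mul_comm]
    _ ≤ N * ‖Q.eval w * w ^ h‖ := by
      gcongr; exact_mod_cast hN1
    _ = ‖(N : ℂ) * (Q.eval w * w ^ h)‖ := by rw [norm_mul _ (_ * _), Complex.norm_natCast]
    _ ≤ _ := by
      rw [key]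
      apply (norm_sum_le _ _).trans
      apply Finset.sum_le_sum
      intro j _
      rw [norm_mul]
      gcongr
      exact H _ (by omega)

lemma exists_fn (s : Multiset ℂ) (N : ℕ) (hs : Multiset.card s = N) : ∃ f : Fin N → ℂ, Finset.univ.val.map f = s := by
  induction s using Quotient.inductionOn with
  | _ l =>
    subst hs
    refine ⟨fun i => l.get i, ?_⟩
    rw [Fin.univ_val_map]
    simp

lemma exists_roots (c : ℕ → ℂ) (N : ℕ) (c0 : c 0 = 1) (hc : ∀ d, N < d → c d = 0) :
    ∃ w : Fin N → ℂ, ∀ d, c d = (-1) ^ d * ∑ t ∈ Finset.powersetCard d Finset.univ, ∏ i ∈ t, w i := by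
  let p : ℂ[X] := ∑ d ∈ Finset.range (N + 1), C (c d) * X ^ (N - d)
  have hco : ∀ d ≤ N, p.coeff (N - d) = c d := by
    intro d hd
    simp only [p, finsetSum_coeff, coeff_C_mul_X_pow]
    rw [Finset.sum_eq_single d]
    · simp
    · intro b hb hbd
      rw [Finset.mem_range] at hb
      rw [if_neg (by omega)]
    · intro h; exact absurd (Finset.mem_range.2 (by omega)) h
  have hdeg : p.natDegree ≤ N := by
    apply natDegree_sum_le_of_forall_le
    intro d _
    exact (natDegree_C_mul_X_pow_le _ _).trans (Nat.sub_le _ _)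
  have hN : p.coeff N = 1 := by rw [← c0, ← hco 0 (Nat.zero_le _), Nat.sub_zero]
  have hmon : p.Monic := monic_of_natDegree_le_of_coeff_eq_one N hdeg hN
  have hdeg' : p.natDegree = N := le_antisymm hdeg (le_natDegree_of_ne_zero (by rw [hN]; exact one_ne_zero))
  have hcard : Multiset.card p.roots = N := by rw [IsAlgClosed.card_roots_eq_natDegree, hdeg']
  obtain ⟨w, hw⟩ := exists_fn p.roots N hcard
  refine ⟨w, fun d => ?_⟩
  rcases le_or_gt d N with hd | hd
  · have h1 := coeff_eq_esymm_roots_of_card (p := p) (by rw [hcard, hdeg']) (k := N - d) (by rw [hdeg']; exact Nat.sub_le _ _)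
    rw [hco d hd, hmon.leadingCoeff, hdeg', one_mul, ← hw, Nat.sub_sub_self hd, Finset.esymm_map_val] at h1
    exact h1
  · rw [hc d hd, Finset.powersetCard_eq_empty.2 (by simpa using hd)]
    simp

lemma newton {N : ℕ} (w : Fin N → ℂ) (d : ℕ) : (d : ℂ) * ((-1) ^ d * ∑ t ∈ Finset.powersetCard d Finset.univ, ∏ i ∈ t, w i)
    = ∑ n ∈ Finset.Icc 1 d, (-∑ i, w i ^ n) * ((-1) ^ (d - n) * ∑ t ∈ Finset.powersetCard (d - n) Finset.univ, ∏ i ∈ t, w i) := by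
  have h := congrArg (MvPolynomial.aeval w) (MvPolynomial.mul_esymm_eq_sum (Fin N) ℂ d)
  simp only [map_mul, map_natCast, map_pow, map_neg, map_one, map_sum, MvPolynomial.esymm, MvPolynomial.psum, map_prod, MvPolynomial.aeval_X] at h
  rw [mul_left_comm, h, ← mul_assoc, ← pow_add, show d + (d + 1) = 2 * d + 1 by ring, pow_succ, pow_mul]
  norm_num
  symm
  apply Finset.sum_bij (fun n _ => (d - n, n))
  · intro n hn
    rw [Finset.mem_Icc] at hn
    simp; omega
  · intro a _ b _ hab
    simpa using (Prod.ext_iff.1 hab).2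
  · rintro ⟨a, b⟩ hab
    simp at hab
    refine ⟨b, by rw [Finset.mem_Icc]; omega, ?_⟩
    ext <;> simp; omega
  · intro n _
    ring

theorem RH (c S : ℕ → ℂ) (N : ℕ) (c0 : c 0 = 1) (hc : ∀ d, N < d → c d = 0)
    (hrec : ∀ d : ℕ, (d : ℂ) * c d = ∑ n ∈ Finset.Icc 1 d, S n * c (d - n)) (q C : ℝ) (hq : 0 < q) (h0 : ℕ)
    (hS : ∀ h, h0 ≤ h → ‖S (2 * h)‖ ≤ C * q ^ h) (d : ℕ) : ‖c d‖ ≤ N.choose d * Real.sqrt q ^ d := by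
  obtain ⟨w, hw⟩ := exists_roots c N c0 hc
  have hSn : ∀ n, 1 ≤ n → S n = -∑ i, w i ^ n := by
    intro n
    induction n using Nat.strong_induction_on with
    | _ n ih =>
      intro hn
      have h1 := hrec n
      have h2 := newton w n
      simp only [← hw] at h2
      rw [h1, ← Finset.Ico_insert_right hn] at h2
      rw [Finset.sum_insert (by simp), Finset.sum_insert (by simp), Nat.sub_self, c0, mul_one, mul_one] at h2
      have h3 : ∑ x ∈ Finset.Ico 1 n, S x * c (n - x) = ∑ x ∈ Finset.Ico 1 n, (-∑ i, w i ^ x) * c (n - x) := by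
        apply Finset.sum_congr rfl
        intro x hx
        rw [Finset.mem_Ico] at hx
        rw [ih x hx.2 hx.1]
      rw [h3] at h2
      exact add_right_cancel h2
  have hwb : ∀ i, ‖w i‖ ≤ Real.sqrt q := by
    intro i
    have h1 := psum_bdd (fun i => w i ^ 2 / q) C (h0 + 1) (fun h hh => by
      have h2 := hS h (by omega)
      rw [hSn _ (by omega), norm_neg] at h2
      simp only [div_pow, ← pow_mul, ← Finset.sum_div]
      rw [norm_div, norm_pow, Complex.norm_real, Real.norm_of_nonneg hq.le, div_le_iff₀ (by positivity)]
      exact h2) i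
    rw [norm_div, norm_pow, Complex.norm_real, Real.norm_of_nonneg hq.le, div_le_one hq] at h1
    exact Real.le_sqrt_of_sq_le h1
  rw [hw, norm_mul, norm_pow, norm_neg, norm_one, one_pow, one_mul]
  calc _ ≤ ∑ t ∈ Finset.powersetCard d (Finset.univ : Finset (Fin N)), ‖∏ i ∈ t, w i‖ := norm_sum_le _ _
    _ ≤ ∑ t ∈ Finset.powersetCard d (Finset.univ : Finset (Fin N)), Real.sqrt q ^ d := by
      apply Finset.sum_le_sum
      intro t ht
      rw [norm_prod, ← (Finset.mem_powersetCard.1 ht).2, ← Finset.prod_const]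
      exact Finset.prod_le_prod (fun _ _ => norm_nonneg _) (fun i _ => hwb i)
    _ = _ := by simp [Finset.card_powersetCard]

end Step

set_option linter.unusedSectionVars false
namespace Step

noncomputable def DD (A : ℝ) (j : ℕ) : ℝ := ∏ i ∈ Finset.range j, (A + i) / (i + 1)

lemma DD_succ (A : ℝ) (j : ℕ) : DD A (j + 1) = DD A j * ((A + j) / (j + 1)) := Finset.prod_range_succ _ _

lemma DD_pos (A : ℝ) (hA : 1 ≤ A) (j : ℕ) : 0 ≤ DD A j := by
  unfold DD; positivity

lemma DD_mono (A : ℝ) (hA : 1 ≤ A) : Monotone (DD A) := by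
  apply monotone_nat_of_le_succ
  intro j
  rw [DD_succ]
  apply le_mul_of_one_le_right (DD_pos A hA j)
  rw [one_le_div (by positivity)]
  linarith

lemma DD_sum (A : ℝ) (j : ℕ) : (j : ℝ) * DD A j = A * ∑ i ∈ Finset.Icc 1 j, DD A (j - i) := by
  have h : (j : ℝ) * DD A j = A * ∑ i ∈ Finset.range j, DD A i := by
    induction j with
    | zero => simp
    | succ j ih =>
      rw [Finset.sum_range_succ, mul_add, ← ih, DD_succ]
      push_cast
      field_simp
      ring
  rw [h, ← Finset.sum_range_reflect]
  congr 1
  apply Finset.sum_bij (fun i _ => i + 1)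
  · intro i hi; rw [Finset.mem_range] at hi; rw [Finset.mem_Icc]; omega
  · intro a _ b _ h; omega
  · intro b hb; rw [Finset.mem_Icc] at hb; exact ⟨b - 1, by rw [Finset.mem_range]; omega, by omega⟩
  · intro i _; congr 1; omega

lemma block (p : ℕ) (hp : 1 ≤ p) (a : ℕ → ℝ) (ha : Antitone a) (hpos : ∀ i, 0 ≤ a i) (j : ℕ) :
    p * ∑ i ∈ (Finset.Icc 1 j).filter (fun i => p ∣ i), a i ≤ ∑ i ∈ Finset.Icc 1 j, a i := by
  have key : ((j % p : ℕ) : ℝ) * a j ≤ ∑ i ∈ Finset.Icc 1 j, a i -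
      p * ∑ i ∈ (Finset.Icc 1 j).filter (fun i => p ∣ i), a i := by
    induction j with
    | zero => simp
    | succ j ih =>
      rw [Finset.sum_filter] at ih ⊢
      rw [Finset.sum_Icc_succ_top (by omega), Finset.sum_Icc_succ_top (by omega)]
      have hm := ha (Nat.le_succ j)
      simp only [Nat.succ_eq_add_one] at hm
      split_ifs with hd
      · have h1 : j % p + 1 = p := by
          have h2 : j % p < p := Nat.mod_lt _ (by omega)
          have h3 : p ∣ j % p + 1 := by
            have := Nat.div_add_mod j p
            have h4 : j + 1 = p * (j / p) + (j % p + 1) := by omega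
            rw [h4] at hd
            exact (Nat.dvd_add_right (Dvd.intro _ rfl)).1 hd
          exact le_antisymm h2 (Nat.le_of_dvd (by omega) h3)
        rw [Nat.mod_eq_zero_of_dvd hd]
        have h2 : ((j % p : ℕ) : ℝ) + 1 = p := by exact_mod_cast h1
        have h3 : (0:ℝ) ≤ ((j % p : ℕ) : ℝ) := Nat.cast_nonneg _
        have h5 := mul_le_mul_of_nonneg_left hm h3
        rw [show (p : ℝ) * ((∑ k ∈ Finset.Icc 1 j, if p ∣ k then a k else 0) + a (j + 1)) =
          p * (∑ k ∈ Finset.Icc 1 j, if p ∣ k then a k else 0) + ((j % p : ℕ) : ℝ) * a (j + 1) + a (j + 1) by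
            rw [mul_add, ← h2]; ring]
        push_cast
        linarith
      · have h1 : (j + 1) % p ≤ j % p + 1 := by
          rw [Nat.add_mod]
          exact (Nat.mod_le _ _).trans (Nat.add_le_add_left (Nat.mod_le _ _) _)
        have h2 : (((j + 1) % p : ℕ) : ℝ) ≤ ((j % p : ℕ) : ℝ) + 1 := by exact_mod_cast h1
        have h3 : (0:ℝ) ≤ ((j % p : ℕ) : ℝ) := Nat.cast_nonneg _
        nlinarith [mul_le_mul_of_nonneg_left hm h3, mul_le_mul_of_nonneg_right h2 (hpos (j + 1))]
  have : 0 ≤ ((j % p : ℕ) : ℝ) * a j := mul_nonneg (Nat.cast_nonneg _) (hpos j)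
  linarith

noncomputable def ee {ι : Type*} [Fintype ι] (x : ι → ℂ) (j : ℕ) : ℂ :=
  ∑ t ∈ Finset.powersetCard j Finset.univ, ∏ i ∈ t, x i

lemma newton_le {ι : Type*} [Fintype ι] (x : ι → ℂ) (j : ℕ) :
    (j : ℝ) * ‖ee x j‖ ≤ ∑ n ∈ Finset.Icc 1 j, ‖∑ i, x i ^ n‖ * ‖ee x (j - n)‖ := by
  classical
  let e := Fintype.equivFin ι
  have hee : ∀ d, ee x d = ∑ t ∈ Finset.powersetCard d Finset.univ, ∏ i ∈ t, (x ∘ e.symm) i := by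
    intro d
    have h1 := MvPolynomial.aeval_esymm_eq_multiset_esymm ι ℂ (n := d) (f := x)
    have h2 := MvPolynomial.aeval_esymm_eq_multiset_esymm (Fin (Fintype.card ι)) ℂ (n := d) (f := x ∘ e.symm)
    simp only [MvPolynomial.esymm, map_sum, map_prod, MvPolynomial.aeval_X] at h1 h2
    rw [ee, h1, h2]
    congr 1
    rw [← Multiset.map_map]
    congr 1
    have := Finset.map_univ_equiv e.symm
    have h3 := congrArg Finset.val this
    rw [Finset.map_val] at h3
    exact h3.symm
  have h := newton (x ∘ e.symm) j
  have hp : ∀ n, ∑ i, (x ∘ e.symm) i ^ n = ∑ i, x i ^ n := fun n => Equiv.sum_comp e.symm (fun i => x i ^ n)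
  simp only [← hee, hp] at h
  have h' := congrArg norm h
  rw [norm_mul, norm_mul, norm_pow, norm_neg, norm_one, one_pow, one_mul, Complex.norm_natCast] at h'
  rw [h']
  apply (norm_sum_le _ _).trans
  apply Finset.sum_le_sum
  intro n _
  simp

theorem ee_bound {ι : Type*} [Fintype ι] (x : ι → ℂ) (p : ℕ) (hp : 1 ≤ p) (B q : ℝ) (hB : 0 ≤ B) (hq : p ≤ q)
    (h1 : ∀ i, ¬ p ∣ i → ‖∑ a, x a ^ i‖ ≤ B) (h2 : ∀ i, ‖∑ a, x a ^ i‖ ≤ q) (j : ℕ) :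
    ‖ee x j‖ ≤ DD (q / p + B) j := by
  have hp0 : (0:ℝ) < p := by exact_mod_cast hp
  have hA : 1 ≤ q / p + B := by
    have : 1 ≤ q / p := by rwa [one_le_div hp0]
    linarith
  set A := q / p + B with hAdef
  have hq0 : 0 ≤ q := hp0.le.trans hq
  induction j using Nat.strong_induction_on with
  | _ j ih =>
    rcases Nat.eq_zero_or_pos j with rfl | hj
    · simp [ee, DD]
    have hj0 : (0:ℝ) < j := by exact_mod_cast hj
    apply le_of_mul_le_mul_left _ hj0
    apply (newton_le x j).trans
    calc _ ≤ ∑ n ∈ Finset.Icc 1 j, (B + if p ∣ n then q else 0) * DD A (j - n) := by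
          apply Finset.sum_le_sum
          intro n hn
          rw [Finset.mem_Icc] at hn
          apply mul_le_mul _ (ih _ (by omega)) (norm_nonneg _)
          · split_ifs <;> linarith
          · split_ifs with hd
            · linarith [h2 n]
            · linarith [h1 n hd]
      _ = B * ∑ n ∈ Finset.Icc 1 j, DD A (j - n) + q * ∑ n ∈ (Finset.Icc 1 j).filter (fun n => p ∣ n), DD A (j - n) := by
          rw [Finset.sum_filter, Finset.mul_sum, Finset.mul_sum, ← Finset.sum_add_distrib]
          apply Finset.sum_congr rfl
          intro n _
          split_ifs <;> ring
      _ ≤ B * ∑ n ∈ Finset.Icc 1 j, DD A (j - n) + q * ((∑ n ∈ Finset.Icc 1 j, DD A (j - n)) / p) := by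
          gcongr
          rw [le_div_iff₀ hp0, mul_comm]
          exact block p hp (fun n => DD A (j - n)) (fun a b hab => DD_mono A hA (by omega)) (fun _ => DD_pos A hA _) j
      _ = j * DD A j := by
          rw [DD_sum, hAdef]; ring

lemma DD_le_gchoose (A A' : ℝ) (hA : 0 ≤ A) (hAA : A ≤ A') (j : ℕ) : DD A j ≤ gchoose (A' + j) j := by
  have hA' : 0 ≤ A' := hA.trans hAA
  have h : gchoose (A' + j) j = ∏ i ∈ Finset.range j, (A' + 1 + i) / (i + 1) := by
    unfold gchoose
    rw [show A' + (j : ℝ) - j + 1 = A' + 1 by ring, Real.Gamma_nat_eq_factorial]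
    have hG : 0 < Real.Gamma (A' + 1) := Real.Gamma_pos_of_pos (by linarith)
    have h2 : Real.Gamma (A' + j + 1) = Real.Gamma (A' + 1) * ∏ i ∈ Finset.range j, (A' + 1 + i) := by
      induction j with
      | zero => simp
      | succ j ih =>
        rw [Finset.prod_range_succ, ← mul_assoc, ← ih]
        push_cast
        rw [Real.Gamma_add_one (by positivity), mul_comm, show A' + ((j : ℝ) + 1) = A' + j + 1 by ring,
          show A' + 1 + (j : ℝ) = A' + j + 1 by ring]
    rw [h2, Finset.prod_div_distrib]
    have h3 : (∏ i ∈ Finset.range j, ((i : ℝ) + 1)) = (j.factorial : ℝ) := by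
      rw [← Finset.prod_range_add_one_eq_factorial]; push_cast; rfl
    rw [h3]
    field_simp
  rw [h]
  unfold DD
  apply Finset.prod_le_prod
  · intro i _; positivity
  · intro i _
    gcongr
    linarith

section
variable {F : Type*} [Field F] [Fintype F] {m : ℕ} {G : Type*} [AddCommGroup G]

theorem cc_bound (hm : 1 ≤ m) (P : Ph F m G) (ψ : AddChar G ℂ) (hψ : ψ ≠ 0) (d : ℕ) :
    ‖cc (Lam P ψ) d‖ ≤ (m - 1).choose d * Real.sqrt (Fintype.card F) ^ d := by
  classical
  have := P.finite
  have := Fintype.ofFinite G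
  obtain ⟨C, h0, H⟩ := SS_bound hm P
  apply RH (cc (Lam P ψ)) (SS (Lam P ψ)) (m - 1) _ _ (recursion _ (Lam_one P ψ) (Lam_mul P ψ)) (Fintype.card F) C _ h0
  · intro h hh
    exact H h hh ψ hψ
  · simp [cc, Mon_zero, Lam_one]
  · intro d hd
    obtain ⟨t, rfl⟩ : ∃ t, d = t + m := ⟨d - m, by omega⟩
    rw [cc_eq, if_neg hψ]
  · exact_mod_cast Fintype.card_pos

lemma cc_one (Λ : F[X] → ℂ) : cc Λ 1 = ∑ a : F, Λ (X - C a) := by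
  symm
  apply Finset.sum_bij (fun a _ => X - C a)
  · intro a _; rw [mem_Mon]; exact ⟨monic_X_sub_C a, natDegree_X_sub_C a⟩
  · intro a _ b _ h; simpa using h
  · intro h hh
    rw [mem_Mon] at hh
    refine ⟨-h.coeff 0, Finset.mem_univ _, ?_⟩
    have h1 := eq_X_add_C_of_natDegree_le_one hh.2.le
    have h2 : h.coeff 1 = 1 := by rw [← hh.2]; exact hh.1
    rw [h2] at h1
    conv_rhs => rw [h1]
    simp
  · intro a _; rfl

theorem e_bound (p : ℕ) [Fact p.Prime] [CharP F p] (hm : 1 ≤ m) (P : Ph F m G) (ψ : AddChar G ℂ) (hψ : ψ ≠ 0) (j : ℕ) :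
    ‖ee (fun a : F => Lam P ψ (X - C a)) j‖ ≤
      gchoose ((Fintype.card F : ℝ) / p + m * Real.sqrt (Fintype.card F) + j) j := by
  classical
  have := P.finite
  have := Fintype.ofFinite G
  have hp : p.Prime := Fact.out
  obtain ⟨f, _, hf⟩ := FiniteField.card F p
  have hpow : ∀ i, ∑ a : F, Lam P ψ (X - C a) ^ i = cc (Lam P (ψ ^ i)) 1 := by
    intro i
    rw [cc_one]
    apply Finset.sum_congr rfl
    intro a _
    simp [Lam, AddChar.pow_apply]
  have hmr : (1:ℝ) ≤ m := by exact_mod_cast hm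
  refine (ee_bound _ p hp.one_le ((m - 1) * Real.sqrt (Fintype.card F)) (Fintype.card F) ?_ ?_ ?_ ?_ j).trans ?_
  · exact mul_nonneg (by linarith) (Real.sqrt_nonneg _)
  · rw [hf]
    exact_mod_cast Nat.le_self_pow f.pos.ne' p
  · intro i hi
    rw [hpow]
    have hne : ψ ^ i ≠ 0 := by
      intro h0
      apply hψ
      have h1 : ψ ^ (Fintype.card F ^ m) = 1 := by
        rw [← P.card_G]
        ext g
        rw [AddChar.pow_apply, ← AddChar.map_nsmul_eq_pow, card_nsmul_eq_zero]
        simp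
      have hco : Nat.Coprime i (Fintype.card F ^ m) := by
        rw [hf, ← pow_mul]
        exact ((Nat.Prime.coprime_iff_not_dvd hp).2 hi).symm.pow_right _
      have h2 := orderOf_dvd_of_pow_eq_one (show ψ ^ i = 1 from h0)
      have h3 := orderOf_dvd_of_pow_eq_one h1
      have h4 := Nat.dvd_gcd h2 h3
      rw [hco.gcd_eq_one, Nat.dvd_one, orderOf_eq_one_iff] at h4
      exact h4
    have := cc_bound hm P (ψ ^ i) hne 1
    rw [Nat.choose_one_right, pow_one, Nat.cast_sub hm, Nat.cast_one] at this
    exact this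
  · intro i
    apply (norm_sum_le _ _).trans
    have : ∀ a ∈ (Finset.univ : Finset F), ‖Lam P ψ (X - C a) ^ i‖ = 1 := by
      intro a _
      rw [norm_pow, Lam, AddChar.norm_apply, one_pow]
    rw [Finset.sum_congr rfl this]
    simp
  · apply DD_le_gchoose
    · have : (0:ℝ) ≤ (m - 1) * Real.sqrt (Fintype.card F) := mul_nonneg (by linarith) (Real.sqrt_nonneg _)
      positivity
    · have := Real.sqrt_nonneg (Fintype.card F : ℝ)
      nlinarith
end

end Step

set_option linter.unusedSectionVars false
namespace Step

lemma inc_exc (n r L : ℕ) (hn : n ≤ L) (hr : r ≤ L) :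
    ∑ t ∈ Finset.range (L - r + 1), (-1 : ℤ) ^ t * ((r + t).choose r : ℤ) * (n.choose (r + t) : ℤ) = if n = r then 1 else 0 := by
  rcases lt_or_ge n r with h | h
  · rw [if_neg (by omega)]
    apply Finset.sum_eq_zero
    intro t _
    rw [Nat.choose_eq_zero_of_lt (by omega : n < r + t)]; simp
  · have e : ∀ t ∈ Finset.range (L - r + 1), (-1 : ℤ) ^ t * ((r + t).choose r : ℤ) * (n.choose (r + t) : ℤ)
        = (n.choose r : ℤ) * ((-1) ^ t * ((n - r).choose t : ℤ)) := by
      intro t _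
      rcases le_or_gt (r + t) n with h1 | h1
      · have := Nat.choose_mul (n := n) (Nat.le_add_right r t)
        rw [Nat.add_sub_cancel_left] at this
        have h2 : (n.choose (r + t) : ℤ) * ((r + t).choose r : ℤ) = (n.choose r : ℤ) * ((n - r).choose t : ℤ) := by
          exact_mod_cast this
        linear_combination (-1 : ℤ) ^ t * h2
      · rw [Nat.choose_eq_zero_of_lt h1, Nat.choose_eq_zero_of_lt (by omega : n - r < t)]; simp
    rw [Finset.sum_congr rfl e, ← Finset.mul_sum]
    have h3 : ∑ t ∈ Finset.range (L - r + 1), (-1 : ℤ) ^ t * ((n - r).choose t : ℤ) =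
        ∑ t ∈ Finset.range (n - r + 1), (-1 : ℤ) ^ t * ((n - r).choose t : ℤ) := by
      symm
      apply Finset.sum_subset
      · intro t; simp only [Finset.mem_range]; omega
      · intro t _ ht
        rw [Finset.mem_range] at ht
        rw [Nat.choose_eq_zero_of_lt (by omega)]; simp
    rw [h3, Int.alternating_sum_range_choose]
    by_cases hnr : n = r
    · subst hnr; simp
    · rw [if_neg (by omega), if_neg hnr, mul_zero]

section
variable {F : Type*} [Field F] [Fintype F] [DecidableEq F]

noncomputable def MM (f : F[X]) (k j : ℕ) : ℕ :=
  ∑ S ∈ Finset.powersetCard j (Finset.univ : Finset F), ((Lt F k).filter (fun g => ∀ a ∈ S, (f + g).eval a = 0)).card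

noncomputable def PS (S : Finset F) : F[X] := ∏ a ∈ S, (X - C a)

lemma PS_monic (S : Finset F) : (PS S).Monic := monic_prod_of_monic _ _ fun i _ => monic_X_sub_C _

lemma PS_deg (S : Finset F) : (PS S).natDegree = S.card := by
  rw [PS, natDegree_prod_of_monic _ _ (fun i _ => monic_X_sub_C _)]
  simp

lemma PS_dvd (S : Finset F) (h : F[X]) : PS S ∣ h ↔ ∀ a ∈ S, h.eval a = 0 := by
  constructor
  · intro hd a ha
    have h1 : (X - C a) ∣ h := (Finset.dvd_prod_of_mem (fun a : F => X - C a) ha).trans hd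
    exact dvd_iff_isRoot.1 h1
  · intro H
    apply Finset.prod_dvd_of_coprime
    · intro a _ b _ hab
      exact isCoprime_X_sub_C_of_isUnit_sub (sub_ne_zero.2 hab).isUnit
    · intro a ha
      exact dvd_iff_isRoot.2 (H a ha)

lemma N_eq (f : F[X]) (k L r : ℕ) (hr : r ≤ L) (hk : k ≤ L) (hL : 1 ≤ L) (hf : f.natDegree = L) :
    (Nat.card {g : F[X] // g.degree < (k : ℕ) ∧
          (Finset.univ.filter (fun a : F => (f + g).eval a = 0)).card = r} : ℤ) =
    ∑ t ∈ Finset.range (L - r + 1), (-1 : ℤ) ^ t * ((r + t).choose r : ℤ) * (MM f k (r + t) : ℤ) := by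
  classical
  have e1 : Nat.card {g : F[X] // g.degree < (k : ℕ) ∧
          (Finset.univ.filter (fun a : F => (f + g).eval a = 0)).card = r} =
      ((Lt F k).filter (fun g => (Finset.univ.filter (fun a : F => (f + g).eval a = 0)).card = r)).card := by
    apply Nat.subtype_card
    intro g
    rw [Finset.mem_filter, mem_Lt]
  have e2 : ∀ j, MM f k j = ∑ g ∈ Lt F k, ((Finset.univ.filter (fun a : F => (f + g).eval a = 0)).card).choose j := by
    intro j
    unfold MM
    simp_rw [Finset.card_filter]
    rw [Finset.sum_comm]
    apply Finset.sum_congr rfl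
    intro g _
    rw [← Finset.card_filter, ← Finset.card_filter, ← Finset.card_powersetCard]
    congr 1
    ext S
    simp only [Finset.mem_filter, Finset.mem_powersetCard, Finset.subset_univ, true_and]
    constructor
    · rintro ⟨h1, h2⟩
      exact ⟨fun a ha => by simpa using h2 a ha, h1⟩
    · rintro ⟨h1, h2⟩
      exact ⟨h2, fun a ha => by simpa using h1 ha⟩
  have e3 : ∀ g ∈ Lt F k, (Finset.univ.filter (fun a : F => (f + g).eval a = 0)).card ≤ L := by
    intro g hg
    rw [mem_Lt] at hg
    have hf0 : f ≠ 0 := by rintro rfl; simp at hf; omega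
    have hfd : f.degree = L := by rw [degree_eq_natDegree hf0, hf]
    have hd : (f + g).degree = L := by
      rw [degree_add_eq_left_of_degree_lt, hfd]
      rw [hfd]
      exact hg.trans_le (by exact_mod_cast hk)
    have h0 : f + g ≠ 0 := by intro h; rw [h] at hd; simp at hd
    have hd' : (f + g).natDegree = L := natDegree_eq_of_degree_eq_some hd
    rw [← hd']
    refine le_trans ?_ ((f + g).card_roots')
    refine le_trans ?_ (Multiset.toFinset_card_le _)
    apply Finset.card_le_card
    intro a ha
    rw [Multiset.mem_toFinset, mem_roots h0]
    exact (Finset.mem_filter.1 ha).2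
  rw [e1, Finset.card_filter]
  simp_rw [e2]
  push_cast
  simp_rw [Finset.mul_sum]
  rw [Finset.sum_comm]
  apply Finset.sum_congr rfl
  intro g hg
  rw [inc_exc _ r L (e3 g hg) hr]

variable {m : ℕ} {G : Type*} [AddCommGroup G]

lemma fibS [DecidableEq G] (P : Ph F m G) (f : F[X]) (k : ℕ) (hk : 1 ≤ k) (hf : f.natDegree = k + m) (S : Finset F)
    (j : ℕ) (hS : S.card = j) (hj : j ≤ k + m) :
    ((Lt F k).filter (fun g => ∀ a ∈ S, (f + g).eval a = 0)).card =
    ((Mon F (k + m - j)).filter (fun h => P.φ (PS S) + P.φ h = P.φ (C f.leadingCoeff⁻¹ * f))).card := by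
  have hf0 : f ≠ 0 := by rintro rfl; simp at hf; omega
  have hc : f.leadingCoeff ≠ 0 := leadingCoeff_ne_zero.2 hf0
  set c := f.leadingCoeff with hcdef
  have hA : (C c⁻¹ * f).Monic := by
    rw [Monic, leadingCoeff_mul, leadingCoeff_C, ← hcdef, inv_mul_cancel₀ hc]
  have hAd : (C c⁻¹ * f).natDegree = k + m := by
    rw [natDegree_C_mul (inv_ne_zero hc), hf]
  have hcc : (C c : F[X]) * C c⁻¹ = 1 := by rw [← C_mul, mul_inv_cancel₀ hc, C_1]
  have key : ∀ h : F[X], h.Monic → h.natDegree = k + m - j →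
      (P.φ (PS S) + P.φ h = P.φ (C c⁻¹ * f) ↔ (C c * (PS S * h) - f).degree < k) := by
    intro h h1 h2
    rw [← P.mul _ _ (PS_monic S) h1, eq_comm, P.eq_iff_same _ _ hA ((PS_monic S).mul h1) _ k hAd]
    · have : C c * (PS S * h) - f = C c * (PS S * h - C c⁻¹ * f) := by
        rw [mul_sub, ← mul_assoc (C c) (C c⁻¹), hcc, one_mul]
      rw [this, degree_C_mul hc]
    · rw [hAd, (PS_monic S).natDegree_mul h1, PS_deg, h2, hS]; omega
  symm
  apply Finset.card_bij (fun h _ => C c * (PS S * h) - f)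
  · intro h hh
    rw [Finset.mem_filter, mem_Mon] at hh
    rw [Finset.mem_filter, mem_Lt]
    refine ⟨(key h hh.1.1 hh.1.2).1 hh.2, ?_⟩
    rw [← PS_dvd, add_sub_cancel]
    exact Dvd.intro _ (by ring : PS S * (C c * h) = _)
  · intro h hh h' hh' e
    have e1 : C c * (PS S * h) = C c * (PS S * h') := sub_left_inj.1 e
    have e2 := mul_left_cancel₀ (C_ne_zero.2 hc) e1
    exact mul_left_cancel₀ (PS_monic S).ne_zero e2
  · intro g hg
    rw [Finset.mem_filter, mem_Lt, ← PS_dvd] at hg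
    obtain ⟨hg1, w, hw⟩ := hg
    have hfd : f.degree = (k + m : ℕ) := by rw [degree_eq_natDegree hf0, hf]
    have hlt : g.degree < f.degree := by
      rw [hfd]; exact hg1.trans_le (by exact_mod_cast Nat.le_add_right k m)
    have hl : (f + g).leadingCoeff = c := leadingCoeff_add_of_degree_lt' hlt
    have hd : (f + g).natDegree = k + m := by
      rw [natDegree_add_eq_left_of_degree_lt hlt, hf]
    have hwl : w.leadingCoeff = c := by
      rw [hw, leadingCoeff_mul, (PS_monic S).leadingCoeff, one_mul] at hl; exact hl
    have hw0 : w ≠ 0 := by rintro rfl; simp at hwl; exact hc hwl.symm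
    have hwd : w.natDegree = k + m - j := by
      rw [hw, natDegree_mul (PS_monic S).ne_zero hw0, PS_deg, hS] at hd; omega
    have hm1 : (C c⁻¹ * w).Monic := by
      rw [Monic, leadingCoeff_mul, leadingCoeff_C, hwl, inv_mul_cancel₀ hc]
    have hm2 : (C c⁻¹ * w).natDegree = k + m - j := by
      rw [natDegree_C_mul (inv_ne_zero hc), hwd]
    have hE : C c * (PS S * (C c⁻¹ * w)) - f = g := by
      have : C c * (PS S * (C c⁻¹ * w)) = (C c * C c⁻¹) * (PS S * w) := by ring
      rw [this, hcc, one_mul, ← hw]; ring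
    refine ⟨C c⁻¹ * w, ?_, hE⟩
    rw [Finset.mem_filter, mem_Mon]
    refine ⟨⟨hm1, hm2⟩, (key _ hm1 hm2).2 ?_⟩
    rw [hE]; exact hg1

lemma map_ps (ψ : AddChar G ℂ) {ι : Type*} (S : Finset ι) (x : ι → G) : ψ (∑ i ∈ S, x i) = ∏ i ∈ S, ψ (x i) := by
  classical
  induction S using Finset.induction_on with
  | empty => simp
  | insert a s ha ih => rw [Finset.sum_insert ha, Finset.prod_insert ha, AddChar.map_add_eq_mul, ih]

lemma M_char [Fintype G] (P : Ph F m G) (f : F[X]) (k : ℕ) (hk : 1 ≤ k) (hf : f.natDegree = k + m)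
    (j : ℕ) (hj : j ≤ k + m) :
    (Fintype.card F : ℂ) ^ m * (MM f k j : ℂ) = ∑ ψ : AddChar G ℂ, ψ (-(P.φ (C f.leadingCoeff⁻¹ * f))) *
      (ee (fun a : F => Lam P ψ (X - C a)) j * cc (Lam P ψ) (k + m - j)) := by
  classical
  set γ := P.φ (C f.leadingCoeff⁻¹ * f) with hγ
  have e1 : ∀ S ∈ Finset.powersetCard j (Finset.univ : Finset F),
      (Fintype.card F : ℂ) ^ m * ((((Lt F k).filter (fun g => ∀ a ∈ S, (f + g).eval a = 0)).card : ℕ) : ℂ) =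
      ∑ ψ : AddChar G ℂ, ψ (-γ) * ((∏ a ∈ S, Lam P ψ (X - C a)) * cc (Lam P ψ) (k + m - j)) := by
    intro S hS
    rw [fibS P f k hk hf S j (Finset.mem_powersetCard.1 hS).2 hj, Finset.card_filter]
    push_cast
    rw [Finset.mul_sum]
    have e2 : ∀ ψ : AddChar G ℂ, ψ (-γ) * ((∏ a ∈ S, Lam P ψ (X - C a)) * cc (Lam P ψ) (k + m - j)) =
        ∑ h ∈ Mon F (k + m - j), ψ (P.φ (PS S) + P.φ h - γ) := by
      intro ψ
      have e3 : (∏ a ∈ S, Lam P ψ (X - C a)) = ψ (P.φ (PS S)) := by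
        rw [PS, P.prod _ _ (fun i _ => monic_X_sub_C i), map_ps]
        rfl
      rw [e3, cc, Finset.mul_sum, Finset.mul_sum]
      apply Finset.sum_congr rfl
      intro h _
      rw [sub_eq_add_neg, AddChar.map_add_eq_mul, AddChar.map_add_eq_mul, Lam]; ring
    simp_rw [e2]
    rw [Finset.sum_comm]
    apply Finset.sum_congr rfl
    intro h _
    rw [AddChar.sum_apply_eq_ite, P.card_G]
    simp only [sub_eq_zero]
    split_ifs <;> simp
  unfold MM
  push_cast
  rw [Finset.mul_sum, Finset.sum_congr rfl e1, Finset.sum_comm]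
  apply Finset.sum_congr rfl
  intro ψ _
  rw [ee, Finset.sum_mul, Finset.mul_sum]

lemma M_est [Fintype G] (P : Ph F m G) (f : F[X]) (k : ℕ) (hk : 1 ≤ k) (hf : f.natDegree = k + m)
    (j : ℕ) (hj : j ≤ k + m) (B : ℝ) (hB : 0 ≤ B)
    (H : ∀ ψ : AddChar G ℂ, ψ ≠ 0 →
      ‖ee (fun a : F => Lam P ψ (X - C a)) j‖ * ‖cc (Lam P ψ) (k + m - j)‖ ≤ B) :
    |(MM f k j : ℝ) - ((Fintype.card F).choose j : ℝ) * (Fintype.card F : ℝ) ^ ((k : ℤ) - (j : ℤ))| ≤ B := by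
  classical
  have h0 := M_char P f k hk hf j hj
  have hq : (0 : ℝ) < Fintype.card F := by exact_mod_cast Fintype.card_pos
  set q := Fintype.card F with hqd
  rw [← Finset.add_sum_erase _ _ (Finset.mem_univ (0 : AddChar G ℂ))] at h0
  have hL0 : ∀ h : F[X], Lam P (0 : AddChar G ℂ) h = 1 := by intro h; simp [Lam]
  have hmain : (0 : AddChar G ℂ) (-(P.φ (C f.leadingCoeff⁻¹ * f))) *
      (ee (fun a : F => Lam P (0 : AddChar G ℂ) (X - C a)) j * cc (Lam P 0) (k + m - j)) =
      (q.choose j : ℂ) * (q : ℂ) ^ (k + m - j) := by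
    rw [ee, cc]
    simp only [hL0, Finset.prod_const_one, Finset.sum_const, Finset.card_powersetCard, card_Mon]
    simp [← hqd]
  rw [hmain] at h0
  have hsum : ‖∑ ψ ∈ Finset.univ.erase (0 : AddChar G ℂ), ψ (-(P.φ (C f.leadingCoeff⁻¹ * f))) *
      (ee (fun a : F => Lam P ψ (X - C a)) j * cc (Lam P ψ) (k + m - j))‖ ≤ (q : ℝ) ^ m * B := by
    refine (norm_sum_le_of_le _ (n := fun _ => B) ?_).trans ?_
    · intro ψ hψ
      rw [norm_mul, norm_mul, AddChar.norm_apply, one_mul]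
      exact H ψ (Finset.ne_of_mem_erase hψ)
    · rw [Finset.sum_const, nsmul_eq_mul]
      apply mul_le_mul_of_nonneg_right _ hB
      have h1 : (Finset.univ.erase (0 : AddChar G ℂ)).card ≤ q ^ m := by
        refine (Finset.card_le_card (Finset.erase_subset _ _)).trans ?_
        rw [Finset.card_univ, AddChar.card_eq, P.card_G]
      exact_mod_cast h1
  rw [← sub_eq_iff_eq_add'.2 h0] at hsum
  have hz : (q : ℝ) ^ (k + m - j) = (q : ℝ) ^ m * (q : ℝ) ^ ((k : ℤ) - (j : ℤ)) := by
    rw [← zpow_natCast, ← zpow_natCast, ← zpow_add₀ hq.ne']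
    congr 1
    omega
  have hcast : (q : ℂ) ^ m * (MM f k j : ℂ) - (q.choose j : ℂ) * (q : ℂ) ^ (k + m - j) =
      (((q : ℝ) ^ m * ((MM f k j : ℝ) - (q.choose j : ℝ) * (q : ℝ) ^ ((k : ℤ) - (j : ℤ))) : ℝ) : ℂ) := by
    rw [mul_sub, mul_left_comm, ← hz]
    push_cast
    ring
  rw [hcast, Complex.norm_real, Real.norm_eq_abs, abs_mul, abs_of_pos (pow_pos hq m)] at hsum
  exact le_of_mul_le_mul_left hsum (pow_pos hq m)

theorem final (q p : ℕ) (hcard : Fintype.card F = q) [hp : Fact p.Prime] [CharP F p]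
    (k m r : ℕ) (hk : 1 ≤ k) (hkm : k + m ≤ q - 1) (hr : r ≤ k + m)
    (f : Polynomial F) (hf : f.natDegree = k + m) :
    |(Nat.card {g : Polynomial F // g.degree < (k : ℕ) ∧
          (Finset.univ.filter (fun a : F => (f + g).eval a = 0)).card = r} : ℝ)
        - (∑ j ∈ Finset.range (k + m - r + 1),
            (-1 : ℝ) ^ j * ((q - r).choose j : ℝ) * ((q : ℝ)⁻¹) ^ j) *
          (q.choose r : ℝ) * (q : ℝ) ^ ((k : ℤ) - (r : ℤ))|
      ≤ ∑ j ∈ Finset.Icc (k + 1) (k + m),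
          (j.choose r : ℝ) *
            gchoose ((q : ℝ) / (p : ℝ) + (m : ℝ) * Real.sqrt q + (j : ℝ)) (j : ℝ) *
            ((m - 1).choose (k + m - j) : ℝ) * Real.sqrt q ^ (k + m - j) := by
  classical
  have := (phi (F := F) m).finite
  have := Fintype.ofFinite (Additive (UU F ⧸ HH F m))
  set P := phi (F := F) m with hP
  have hq : (0 : ℝ) < q := by rw [← hcard]; exact_mod_cast Fintype.card_pos
  have hN := N_eq f k (k + m) r hr (by omega) (by omega) hf
  have hN' : (Nat.card {g : Polynomial F // g.degree < (k : ℕ) ∧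
          (Finset.univ.filter (fun a : F => (f + g).eval a = 0)).card = r} : ℝ) =
      ∑ t ∈ Finset.range (k + m - r + 1), (-1 : ℝ) ^ t * ((r + t).choose r : ℝ) * (MM f k (r + t) : ℝ) := by
    have := congrArg (fun z : ℤ => (z : ℝ)) hN
    push_cast at this
    exact this
  set D : ℕ → ℝ := fun j => (MM f k j : ℝ) - (q.choose j : ℝ) * (q : ℝ) ^ ((k : ℤ) - (j : ℤ)) with hD
  have hdiff : (Nat.card {g : Polynomial F // g.degree < (k : ℕ) ∧
          (Finset.univ.filter (fun a : F => (f + g).eval a = 0)).card = r} : ℝ)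
        - (∑ j ∈ Finset.range (k + m - r + 1),
            (-1 : ℝ) ^ j * ((q - r).choose j : ℝ) * ((q : ℝ)⁻¹) ^ j) *
          (q.choose r : ℝ) * (q : ℝ) ^ ((k : ℤ) - (r : ℤ)) =
      ∑ t ∈ Finset.range (k + m - r + 1), (-1 : ℝ) ^ t * (((r + t).choose r : ℝ) * D (r + t)) := by
    rw [hN', Finset.sum_mul, Finset.sum_mul, ← Finset.sum_sub_distrib]
    apply Finset.sum_congr rfl
    intro t _
    have h1 := Nat.choose_mul (n := q) (Nat.le_add_right r t)
    rw [Nat.add_sub_cancel_left] at h1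
    have h2 : (q.choose (r + t) : ℝ) * ((r + t).choose r : ℝ) = (q.choose r : ℝ) * ((q - r).choose t : ℝ) := by
      exact_mod_cast h1
    have h3 : ((q : ℝ)⁻¹) ^ t * (q : ℝ) ^ ((k : ℤ) - (r : ℤ)) = (q : ℝ) ^ ((k : ℤ) - ((r + t : ℕ) : ℤ)) := by
      rw [inv_pow, ← zpow_natCast, ← zpow_neg, ← zpow_add₀ hq.ne']
      congr 1
      push_cast; ring
    simp only [hD]
    rw [← h3]
    linear_combination (-1 : ℝ) ^ t * (q : ℝ)⁻¹ ^ t * (q : ℝ) ^ ((k : ℤ) - (r : ℤ)) * h2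
  rw [hdiff]
  have hsmall : ∀ j, j ≤ k → D j = 0 := by
    intro j hj
    have := M_est P f k hk hf j (by omega) 0 le_rfl (by
      intro ψ hψ
      have e : k + m - j = (k - j) + m := by omega
      rw [e, cc_eq, if_neg hψ]; simp)
    rw [hcard] at this
    exact abs_nonpos_iff.1 this
  have hbig : ∀ j ∈ Finset.Icc (k + 1) (k + m), |D j| ≤
      gchoose ((q : ℝ) / (p : ℝ) + (m : ℝ) * Real.sqrt q + (j : ℝ)) (j : ℝ) *
            ((m - 1).choose (k + m - j) : ℝ) * Real.sqrt q ^ (k + m - j) := by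
    intro j hj
    rw [Finset.mem_Icc] at hj
    have hm : 1 ≤ m := by omega
    have hg : 0 ≤ gchoose ((q : ℝ) / (p : ℝ) + (m : ℝ) * Real.sqrt q + (j : ℝ)) (j : ℝ) := by
      unfold gchoose
      have a1 : 0 ≤ (q : ℝ) / (p : ℝ) + (m : ℝ) * Real.sqrt q := by positivity
      apply div_nonneg (Real.Gamma_nonneg_of_nonneg (by positivity))
      apply mul_nonneg (Real.Gamma_nonneg_of_nonneg (by positivity))
      apply Real.Gamma_nonneg_of_nonneg
      linarith
    have := M_est P f k hk hf j hj.2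
      (gchoose ((q : ℝ) / (p : ℝ) + (m : ℝ) * Real.sqrt q + (j : ℝ)) (j : ℝ) *
            (((m - 1).choose (k + m - j) : ℝ) * Real.sqrt q ^ (k + m - j))) (by positivity) (by
      intro ψ hψ
      have b1 := e_bound p hm P ψ hψ j
      have b2 := cc_bound hm P ψ hψ (k + m - j)
      rw [hcard] at b1 b2
      exact mul_le_mul b1 b2 (norm_nonneg _) hg)
    rw [hcard] at this
    rw [mul_assoc]
    exact this
  calc _ ≤ ∑ t ∈ Finset.range (k + m - r + 1), (((r + t).choose r : ℝ) * |D (r + t)|) := by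
        refine (Finset.abs_sum_le_sum_abs _ _).trans (Finset.sum_le_sum fun t _ => ?_)
        rw [abs_mul, abs_mul, abs_pow, abs_neg, abs_one, one_pow, one_mul, Nat.abs_cast]
    _ = ∑ j ∈ Finset.Icc r (k + m), ((j.choose r : ℝ) * |D j|) := by
        rw [← Finset.Ico_add_one_right_eq_Icc, Finset.sum_Ico_eq_sum_range]
        congr 2
        omega
    _ ≤ ∑ j ∈ Finset.range (k + m + 1), ((j.choose r : ℝ) * |D j|) := by
        apply Finset.sum_le_sum_of_subset_of_nonneg
        · intro j; simp only [Finset.mem_Icc, Finset.mem_range]; omega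
        · intros; positivity
    _ = ∑ j ∈ Finset.Icc (k + 1) (k + m), ((j.choose r : ℝ) * |D j|) := by
        symm
        apply Finset.sum_subset
        · intro j; simp only [Finset.mem_Icc, Finset.mem_range]; omega
        · intro j h1 h2
          simp only [Finset.mem_Icc, Finset.mem_range] at h1 h2
          rw [hsmall j (by omega)]; simp
    _ ≤ _ := by
        apply Finset.sum_le_sum
        intro j hj
        have := mul_le_mul_of_nonneg_left (hbig j hj) (by positivity : (0:ℝ) ≤ (j.choose r : ℝ))
        simpa only [mul_assoc] using this
end
end Step

/-- Main theorem. For `f` of degree `k+m ≤ q-1` and `0 ≤ r ≤ k+m`,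
`|N(f,r) - μ_{k+m-r} C(q,r) q^(k-r)|
  ≤ ∑_{j=k+1}^{k+m} C(j,r) C(q/p + m√q + j, j) C(m-1, k+m-j) q^((k+m-j)/2)`,
where `N(f,r)` counts polynomials `g` of degree at most `k-1` with `f+g` having exactly
`r` distinct roots in `F_q`, and `μ_s = ∑_{j=0}^s (-1)^j C(q-r,j) q^(-j)`. -/
theorem stmt_10 {F : Type*} [Field F] [Fintype F] [DecidableEq F]
    (q p : ℕ) (hcard : Fintype.card F = q) [hp : Fact p.Prime] [CharP F p]
    (k m r : ℕ) (hk : 1 ≤ k) (hkm : k + m ≤ q - 1) (hr : r ≤ k + m)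
    (f : Polynomial F) (hf : f.natDegree = k + m) :
    |(Nat.card {g : Polynomial F // g.degree < (k : ℕ) ∧
          (Finset.univ.filter (fun a : F => (f + g).eval a = 0)).card = r} : ℝ)
        - (∑ j ∈ Finset.range (k + m - r + 1),
            (-1 : ℝ) ^ j * ((q - r).choose j : ℝ) * ((q : ℝ)⁻¹) ^ j) *
          (q.choose r : ℝ) * (q : ℝ) ^ ((k : ℤ) - (r : ℤ))|
      ≤ ∑ j ∈ Finset.Icc (k + 1) (k + m),
          (j.choose r : ℝ) *
            gchoose ((q : ℝ) / (p : ℝ) + (m : ℝ) * Real.sqrt q + (j : ℝ)) (j : ℝ) *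
            ((m - 1).choose (k + m - j) : ℝ) * Real.sqrt q ^ (k + m - j) := by
  exact Step.final q p hcard k m r hk hkm hr f hf
end
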